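/- arXiv:2402.01277 — 9 statements merged into one kernel-verified Lean document; each statement's English description precedes it below -/
import Mathlib

section
/- Let m be a σ-finite measure on a measurable space X, let p and p' be probability densities with respect to m, and let W : X → [0,∞) be measurable with 0 < Z := ∫ W(x) p(x) m(dx) < ∞. Define the target density π = W p / Z, and assume that for m-a.e. x with π(x) > 0 one has p(x) > 0 and p'(x) > 0, and that KL(π, p) and KL(π, p') are finite. If for some Δ ∈ ℝ the Kullback–Leibler decrease condition KL(π, p') + Δ ≤ KL(π, p) holds, then ∫ W(x) p'(x) m(dx) ≥ exp(Δ) · Z. -/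
open MeasureTheory Set

noncomputable section

/-- **KL decrease implies objective increase.**
If `π = W p / Z` and `KL(π, p') + Δ ≤ KL(π, p)`, then `∫ W p' dm ≥ exp Δ · Z`. -/
theorem kl_decrease_implies_objective_increase
    {X : Type*} [MeasurableSpace X] (m : Measure X) [SigmaFinite m]
    (p p' W : X → ℝ)
    (hp_meas : Measurable p) (hp_nonneg : ∀ x, 0 ≤ p x)
    (hp_int : Integrable p m) (hp_one : ∫ x, p x ∂m = 1)
    (hp'_meas : Measurable p') (hp'_nonneg : ∀ x, 0 ≤ p' x)
    (hp'_int : Integrable p' m) (hp'_one : ∫ x, p' x ∂m = 1)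
    (hW_meas : Measurable W) (hW_nonneg : ∀ x, 0 ≤ W x)
    (hWp_int : Integrable (fun x => W x * p x) m)
    (Z : ℝ) (hZ : Z = ∫ x, W x * p x ∂m) (hZ_pos : 0 < Z)
    (π : X → ℝ) (hπ : ∀ x, π x = W x * p x / Z)
    (hsupp : ∀ᵐ x ∂m, 0 < π x → 0 < p x ∧ 0 < p' x)
    (hKL_p : Integrable (fun x => π x * Real.log (π x / p x)) m)
    (hKL_p' : Integrable (fun x => π x * Real.log (π x / p' x)) m)
    (Δ : ℝ)
    (hdec : (∫ x, π x * Real.log (π x / p' x) ∂m) + Δ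
        ≤ ∫ x, π x * Real.log (π x / p x) ∂m) :
    ENNReal.ofReal (Real.exp Δ * Z) ≤ ∫⁻ x, ENNReal.ofReal (W x * p' x) ∂m := by
  by_cases htop : ∫⁻ x, ENNReal.ofReal (W x * p' x) ∂m = ⊤
  · rw [htop]; exact le_top
  have hnn : ∀ x, 0 ≤ W x * p' x := fun x => mul_nonneg (hW_nonneg x) (hp'_nonneg x)
  have hI : Integrable (fun x => W x * p' x) m := by
    refine ⟨(hW_meas.mul hp'_meas).aestronglyMeasurable, ?_⟩
    rw [hasFiniteIntegral_iff_ofReal (Filter.Eventually.of_forall hnn)]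
    exact lt_top_iff_ne_top.mpr htop
  rw [← ofReal_integral_eq_lintegral_ofReal hI (Filter.Eventually.of_forall hnn)]
  apply ENNReal.ofReal_le_ofReal
  have hπfun : π = fun x => W x * p x / Z := funext hπ
  have hπint : Integrable π m := by rw [hπfun]; exact hWp_int.div_const Z
  have hπone : ∫ x, π x ∂m = 1 := by
    rw [hπfun, integral_div, ← hZ, div_self hZ_pos.ne']
  have key : ∫ x, (π x * Real.log (π x / p x) - π x * Real.log (π x / p' x)) ∂m
      ≤ ∫ x, ((Δ - 1) * π x + Real.exp (-Δ) / Z * (W x * p' x)) ∂m := by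
    refine integral_mono_ae (hKL_p.sub hKL_p')
      ((hπint.const_mul _).add (hI.const_mul _)) ?_
    filter_upwards [hsupp] with x hx
    have hπ0 : 0 ≤ π x := by
      rw [hπ]; exact div_nonneg (mul_nonneg (hW_nonneg x) (hp_nonneg x)) hZ_pos.le
    rcases hπ0.eq_or_lt with h | h
    · simp only [← h, zero_mul, mul_zero, sub_zero, zero_add]
      exact mul_nonneg (div_nonneg (Real.exp_pos _).le hZ_pos.le) (hnn x)
    · obtain ⟨h1, h2⟩ := hx h
      have ht : 0 < Real.exp (-Δ) * (p' x / p x) := by positivity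
      have hl := Real.log_le_sub_one_of_pos ht
      rw [Real.log_mul (Real.exp_pos _).ne' (by positivity), Real.log_exp,
        Real.log_div h2.ne' h1.ne'] at hl
      have he : Real.exp (-Δ) / Z * (W x * p' x) = π x * (Real.exp (-Δ) * (p' x / p x)) := by
        rw [hπ]; field_simp
      simp only [he]
      rw [Real.log_div h.ne' h1.ne', Real.log_div h.ne' h2.ne']
      nlinarith [mul_le_mul_of_nonneg_left hl h.le]
  rw [integral_sub hKL_p hKL_p', integral_add (hπint.const_mul _) (hI.const_mul _),
    integral_const_mul, integral_const_mul, hπone] at key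
  have h1 : 1 ≤ Real.exp (-Δ) / Z * ∫ x, W x * p' x ∂m := by linarith
  rw [Real.exp_neg] at h1
  have h2 := mul_le_mul_of_nonneg_left h1 (mul_pos (Real.exp_pos Δ) hZ_pos).le
  have h3 : Real.exp Δ * Z * ((Real.exp Δ)⁻¹ / Z * ∫ x, W x * p' x ∂m)
      = ∫ x, W x * p' x ∂m := by
    have := (Real.exp_pos Δ).ne'
    field_simp
  rw [h3, mul_one] at h2
  exact h2
end
end

section
/- Let m be a σ-finite measure on a measurable space X, let p and p' be probability densities with respect to m, and let W : X → {0,1} be measurable with 0 < Z := ∫ W(x) p(x) m(dx) < ∞. Define the target density π = W p / Z, assume that for m-a.e. x with π(x) > 0 one has p(x) > 0 and p'(x) > 0, and let α ∈ (0,1) be such that D_α(π, p) and D_α(π, p') are finite. If for some Δ ∈ ℝ the Rényi decrease condition D_α(π, p') + Δ ≤ D_α(π, p) holds, then ∫ W(x) p'(x) m(dx) ≥ exp(Δ) · Z. -/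
open MeasureTheory Set

noncomputable section

/-- **Rényi decrease implies objective increase** (binary weight `W`).
If `π = W p / Z`, `α ∈ (0,1)`, and `D_α(π, p') + Δ ≤ D_α(π, p)`,
then `∫ W p' dm ≥ exp Δ · Z`. -/
theorem renyi_decrease_implies_objective_increase
    {X : Type*} [MeasurableSpace X] (m : Measure X) [SigmaFinite m]
    (p p' W : X → ℝ)
    (hp_meas : Measurable p) (hp_nonneg : ∀ x, 0 ≤ p x)
    (hp_int : Integrable p m) (hp_one : ∫ x, p x ∂m = 1)
    (hp'_meas : Measurable p') (hp'_nonneg : ∀ x, 0 ≤ p' x)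
    (hp'_int : Integrable p' m) (hp'_one : ∫ x, p' x ∂m = 1)
    (hW_meas : Measurable W) (hW01 : ∀ x, W x = 0 ∨ W x = 1)
    (hWp_int : Integrable (fun x => W x * p x) m)
    (Z : ℝ) (hZ : Z = ∫ x, W x * p x ∂m) (hZ_pos : 0 < Z)
    (π : X → ℝ) (hπ : ∀ x, π x = W x * p x / Z)
    (hsupp : ∀ᵐ x ∂m, 0 < π x → 0 < p x ∧ 0 < p' x)
    (α : ℝ) (hα : α ∈ Ioo (0:ℝ) 1)
    (hfin_p : Integrable (fun x => π x ^ α * p x ^ (1 - α)) m)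
    (hpos_p : 0 < ∫ x, π x ^ α * p x ^ (1 - α) ∂m)
    (hfin_p' : Integrable (fun x => π x ^ α * p' x ^ (1 - α)) m)
    (hpos_p' : 0 < ∫ x, π x ^ α * p' x ^ (1 - α) ∂m)
    (Δ : ℝ)
    (hdec : (α - 1)⁻¹ * Real.log (∫ x, π x ^ α * p' x ^ (1 - α) ∂m) + Δ
        ≤ (α - 1)⁻¹ * Real.log (∫ x, π x ^ α * p x ^ (1 - α) ∂m)) :
    Real.exp Δ * Z ≤ ∫ x, W x * p' x ∂m := by
  obtain ⟨h0, h1⟩ := hα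
  have h1' : 0 < 1 - α := by linarith
  have hW0 : ∀ x, 0 ≤ W x := fun x => by rcases hW01 x with h | h <;> simp [h]
  have hW1 : ∀ x, W x ≤ 1 := fun x => by rcases hW01 x with h | h <;> simp [h]
  have hWp'_int : Integrable (fun x => W x * p' x) m := by
    refine hp'_int.mono (hW_meas.mul hp'_meas).aestronglyMeasurable (Filter.Eventually.of_forall fun x => ?_)
    rw [Real.norm_of_nonneg (mul_nonneg (hW0 x) (hp'_nonneg x)), Real.norm_of_nonneg (hp'_nonneg x)]
    exact mul_le_of_le_one_left (hp'_nonneg x) (hW1 x)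
  have hπ0 : ∀ x, 0 ≤ π x := fun x => by
    rw [hπ]; exact div_nonneg (mul_nonneg (hW0 x) (hp_nonneg x)) hZ_pos.le
  have hπfun : π = fun x => W x * p x / Z := funext hπ
  have hπ_int : Integrable π m := by rw [hπfun]; exact hWp_int.div_const Z
  have hπ_one : ∫ x, π x ∂m = 1 := by
    rw [hπfun, integral_div, ← hZ]; exact div_self hZ_pos.ne'
  -- the first integral
  have hI : ∫ x, π x ^ α * p x ^ (1 - α) ∂m = Z ^ (1 - α) := by
    have : ∀ x, π x ^ α * p x ^ (1 - α) = (W x * p x) * (Z ^ α)⁻¹ := by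
      intro x
      rw [hπ]
      rcases hW01 x with h | h
      · simp [h, h0.ne']
      · rw [h, one_mul, Real.div_rpow (hp_nonneg x) hZ_pos.le, div_mul_eq_mul_div,
          ← Real.rpow_add' (hp_nonneg x) (by norm_num), div_eq_mul_inv]
        norm_num
    simp_rw [this]
    rw [integral_mul_const, ← hZ, Real.rpow_sub hZ_pos, Real.rpow_one, div_eq_mul_inv]
  have hWI : ∀ x, π x ^ α * p' x ^ (1 - α) = π x ^ α * (W x * p' x) ^ (1 - α) := by
    intro x
    rcases hW01 x with h | h
    · rw [hπ]; simp [h, h0.ne']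
    · simp [h]
  have hWp'0 : ∀ x, 0 ≤ W x * p' x := fun x => mul_nonneg (hW0 x) (hp'_nonneg x)
  set Z' := ∫ x, W x * p' x ∂m with hZ'
  have hZ'0 : 0 ≤ Z' := integral_nonneg hWp'0
  have hZ'pos : 0 < Z' := by
    rcases hZ'0.lt_or_eq with h | h
    · exact h
    · exfalso
      have hae := (integral_eq_zero_iff_of_nonneg hWp'0 hWp'_int).1 h.symm
      have : ∫ x, π x ^ α * p' x ^ (1 - α) ∂m = 0 := by
        apply integral_eq_zero_of_ae
        filter_upwards [hae] with x hx
        have hx' : W x * p' x = 0 := hx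
        rw [hWI, hx', Real.zero_rpow h1'.ne', mul_zero]; rfl
      linarith
  have hle : ∫ x, π x ^ α * p' x ^ (1 - α) ∂m ≤ Z' ^ (1 - α) := by
    have hb : ∀ x, π x ^ α * p' x ^ (1 - α) ≤
        Z' ^ (1 - α) * (α * π x + (1 - α) * (W x * p' x / Z')) := by
      intro x
      have h := Real.geom_mean_le_arith_mean2_weighted h0.le h1'.le (hπ0 x)
        (div_nonneg (hWp'0 x) hZ'0) (by ring)
      rw [hWI]
      refine le_trans (le_of_eq ?_) (mul_le_mul_of_nonneg_left h (Real.rpow_nonneg hZ'0 _))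
      rw [Real.div_rpow (hWp'0 x) hZ'0]
      have := (Real.rpow_pos_of_pos hZ'pos (1 - α)).ne'
      field_simp
    have hi1 : Integrable (fun x => α * π x) m := hπ_int.const_mul α
    have hi2 : Integrable (fun x => (1 - α) * (W x * p' x / Z')) m :=
      (hWp'_int.div_const Z').const_mul _
    refine (integral_mono hfin_p' ((hi1.add hi2).const_mul _) hb).trans (le_of_eq ?_)
    rw [integral_const_mul]
    simp only [Pi.add_apply]
    rw [integral_add hi1 hi2, integral_const_mul, integral_const_mul, integral_div, hπ_one, ← hZ',
      div_self hZ'pos.ne']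
    ring
  have hlog := Real.log_le_log hpos_p' hle
  rw [Real.log_rpow hZ'pos] at hlog
  rw [hI, Real.log_rpow hZ_pos] at hdec
  have hm := mul_le_mul_of_nonpos_left hlog (inv_nonpos.2 (by linarith : α - 1 ≤ 0))
  have e : ∀ y : ℝ, (α - 1)⁻¹ * ((1 - α) * y) = -y := by
    intro y
    have : α - 1 ≠ 0 := by linarith
    field_simp
    ring
  rw [e] at hm hdec
  have hf : Δ + Real.log Z ≤ Real.log Z' := by linarith
  rw [← Real.exp_log hZ_pos, ← Real.exp_add, ← Real.exp_log hZ'pos]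
  simpa using hf
end
end

section
/- Let m be a σ-finite measure on a measurable space X, f : X → ℝ measurable, q ∈ (0,1), and let p and p' be probability densities with respect to m. Let W_{p'}^f be the preference function associated with p' and the indicator weighting w(u) = 1_{u ≤ q}, and let Q_p^q(f), Q_{p'}^q(f) be the q-quantiles of f under p and p'. If ∫ W_{p'}^f(x) p(x) m(dx) > q and moreover P_{X∼p}[f(X) = Q_{p'}^q(f)] = 0, then Q_p^q(f) < Q_{p'}^q(f). -/
open MeasureTheory Set

noncomputable section

variable {X : Type*} [MeasurableSpace X]

/-- `P_{X∼p}[f(X) ≤ u]` for a density `p` w.r.t. `m`. -/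
def probLe (m : Measure X) (p f : X → ℝ) (u : ℝ) : ℝ := ∫ x in {y | f y ≤ u}, p x ∂m

/-- `P_{X∼p}[f(X) ≥ u]` for a density `p` w.r.t. `m`. -/
def probGe (m : Measure X) (p f : X → ℝ) (u : ℝ) : ℝ := ∫ x in {y | u ≤ f y}, p x ∂m

/-- The `q`-quantile `Q_p^q(f)`: the supremum of the `u` with
`P[f(X) ≤ u] ≥ q` and `P[f(X) ≥ u] ≥ 1 - q`. -/
def quantQ (m : Measure X) (p f : X → ℝ) (q : ℝ) : ℝ :=
  sSup {u : ℝ | q ≤ probLe m p f u ∧ 1 - q ≤ probGe m p f u}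

/-- `q_p^≤(x) = P_{X∼p}[f(X) ≤ f(x)]`. -/
def qle (m : Measure X) (p f : X → ℝ) (x : X) : ℝ := ∫ y in {y | f y ≤ f x}, p y ∂m

/-- `q_p^<(x) = P_{X∼p}[f(X) < f(x)]`. -/
def qlt (m : Measure X) (p f : X → ℝ) (x : X) : ℝ := ∫ y in {y | f y < f x}, p y ∂m

/-- The preference function `W_p^f` for the indicator weighting `w(u) = 1_{u ≤ q}`. -/
def prefW (m : Measure X) (p f : X → ℝ) (q : ℝ) (x : X) : ℝ :=
  if qle m p f x = qlt m p f x then (if qle m p f x ≤ q then 1 else 0)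
  else (min (qle m p f x) q - min (qlt m p f x) q) / (qle m p f x - qlt m p f x)

lemma aux_lim (ν : Measure ℝ) [IsProbabilityMeasure ν] (a q : ℝ)
    (h : ∀ v < a, ν.real (Iic v) ≤ q) : ν.real (Iio a) ≤ q := by
  have h1 : ν (Iio a) = ENNReal.ofReal (Function.leftLim (ProbabilityTheory.cdf ν) a - 0) := by
    conv_lhs => rw [← ProbabilityTheory.measure_cdf ν]
    exact StieltjesFunction.measure_Iio _ (ProbabilityTheory.tendsto_cdf_atBot ν) a
  have h2 : Function.leftLim (ProbabilityTheory.cdf ν) a ≤ q := by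
    refine le_of_tendsto ((ProbabilityTheory.cdf ν).mono.tendsto_leftLim a) ?_
    filter_upwards [self_mem_nhdsWithin] with v hv
    rw [ProbabilityTheory.cdf_eq_real]
    exact h v hv
  have hq : 0 ≤ q := le_trans measureReal_nonneg (h (a-1) (by linarith))
  rw [measureReal_def, h1, sub_zero]
  exact ENNReal.toReal_le_of_le_ofReal hq (ENNReal.ofReal_le_ofReal h2)

lemma aux_up (ν : Measure ℝ) [IsProbabilityMeasure ν] (q : ℝ) (h1 : q < 1) :
    ∃ v, q < ν.real (Iic v) := by
  obtain ⟨v, hv⟩ := ((ProbabilityTheory.tendsto_cdf_atTop ν).eventually (lt_mem_nhds h1)).exists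
  exact ⟨v, by rwa [ProbabilityTheory.cdf_eq_real] at hv⟩

lemma aux_le (ν : Measure ℝ) [IsProbabilityMeasure ν] (q u v : ℝ)
    (hv : q < ν.real (Iic v)) (hu : ν.real (Iio u) ≤ q) : u ≤ v := by
  by_contra! hc
  have : ν.real (Iic v) ≤ ν.real (Iio u) :=
    measureReal_mono (fun x hx => lt_of_le_of_lt hx hc)
  linarith

lemma aux_nonempty (ν : Measure ℝ) [IsProbabilityMeasure ν] (q : ℝ) (h0 : 0 < q) (h1 : q < 1) :
    ∃ a, q ≤ ν.real (Iic a) ∧ ν.real (Iio a) ≤ q := by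
  let A := {u : ℝ | q ≤ ν.real (Iic u)}
  have hne : A.Nonempty := (aux_up ν q h1).imp fun v hv => le_of_lt hv
  obtain ⟨b, hb⟩ := ((ProbabilityTheory.tendsto_cdf_atBot ν).eventually (gt_mem_nhds h0)).exists
  rw [ProbabilityTheory.cdf_eq_real] at hb
  have hbd : BddBelow A := ⟨b, fun u (hu : q ≤ _) => by
    by_contra! hc
    have : ν.real (Iic u) ≤ ν.real (Iic b) := measureReal_mono (Iic_subset_Iic.2 hc.le)
    linarith⟩
  refine ⟨sInf A, ?_, ?_⟩
  · have hc : Filter.Tendsto (ProbabilityTheory.cdf ν) (nhdsWithin (sInf A) (Ioi (sInf A)))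
        (nhds (ProbabilityTheory.cdf ν (sInf A))) :=
      ((ProbabilityTheory.cdf ν).right_continuous (sInf A)).mono_left
        (nhdsWithin_mono _ Ioi_subset_Ici_self)
    rw [← ProbabilityTheory.cdf_eq_real]
    refine ge_of_tendsto hc ?_
    filter_upwards [self_mem_nhdsWithin] with v hv
    obtain ⟨u, hu, huv⟩ := exists_lt_of_csInf_lt hne hv
    rw [ProbabilityTheory.cdf_eq_real]
    exact le_trans hu (measureReal_mono (Iic_subset_Iic.2 huv.le))
  · refine aux_lim ν _ q fun v hv => ?_
    have := notMem_of_lt_csInf hv hbd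
    exact le_of_not_ge this

lemma aux_density (m : Measure X) (f : X → ℝ) (hf : Measurable f) (p : X → ℝ)
    (hp_nonneg : ∀ x, 0 ≤ p x) (hp_int : Integrable p m) (hp_one : ∫ x, p x ∂m = 1) :
    ∃ ν : Measure ℝ, IsProbabilityMeasure ν ∧
      ∀ s, MeasurableSet s → ∫ x in f ⁻¹' s, p x ∂m = ν.real s := by
  have key : ∀ s, MeasurableSet s → ((m.withDensity fun x => ENNReal.ofReal (p x)).map f) s
      = ENNReal.ofReal (∫ x in f ⁻¹' s, p x ∂m) := by
    intro s hs
    rw [Measure.map_apply hf hs, withDensity_apply _ (hf hs),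
      ofReal_integral_eq_lintegral_ofReal hp_int.integrableOn (Filter.Eventually.of_forall hp_nonneg)]
  refine ⟨(m.withDensity fun x => ENNReal.ofReal (p x)).map f, ⟨?_⟩, fun s hs => ?_⟩
  · rw [key _ MeasurableSet.univ]; simp [hp_one]
  · rw [measureReal_def, key s hs, ENNReal.toReal_ofReal (integral_nonneg hp_nonneg)]

lemma aux_set (m : Measure X) (f p : X → ℝ) (q : ℝ) (ν : Measure ℝ) [IsProbabilityMeasure ν]
    (h : ∀ s, MeasurableSet s → ∫ x in f ⁻¹' s, p x ∂m = ν.real s) :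
    quantQ m p f q = sSup {u : ℝ | q ≤ ν.real (Iic u) ∧ ν.real (Iio u) ≤ q} := by
  unfold quantQ
  congr 1
  ext u
  have h1 : probLe m p f u = ν.real (Iic u) := h _ measurableSet_Iic
  have h2 : probGe m p f u = ν.real (Ici u) := h _ measurableSet_Ici
  have h3 : ν.real (Ici u) = 1 - ν.real (Iio u) := by
    rw [← compl_Iio, probReal_compl_eq_one_sub measurableSet_Iio]
  simp only [mem_setOf_eq, h1, h2, h3]
  constructor <;> rintro ⟨a, b⟩ <;> exact ⟨a, by linarith⟩

/-- **Lemma 8 (second part), Akimoto et al.**: if `∫ W_{p'}^f p dm > q` and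
`P_{X∼p}[f(X) = Q_{p'}^q(f)] = 0`, then `Q_p^q(f) < Q_{p'}^q(f)`. -/
theorem objective_increase_implies_strict_quantile_improvement
    (m : Measure X) [SigmaFinite m]
    (f : X → ℝ) (hf : Measurable f) (q : ℝ) (hq : q ∈ Ioo (0:ℝ) 1)
    (p p' : X → ℝ)
    (hp_meas : Measurable p) (hp_nonneg : ∀ x, 0 ≤ p x)
    (hp_int : Integrable p m) (hp_one : ∫ x, p x ∂m = 1)
    (hp'_meas : Measurable p') (hp'_nonneg : ∀ x, 0 ≤ p' x)
    (hp'_int : Integrable p' m) (hp'_one : ∫ x, p' x ∂m = 1)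
    (hJ : q < ∫ x, prefW m p' f q x * p x ∂m)
    (hatom : ∫ x in {y | f y = quantQ m p' f q}, p x ∂m = 0) :
    quantQ m p f q < quantQ m p' f q := by
  obtain ⟨hq0, hq1⟩ := hq
  obtain ⟨ν, hν, hνs⟩ := aux_density m f hf p hp_nonneg hp_int hp_one
  obtain ⟨ν', hν', hνs'⟩ := aux_density m f hf p' hp'_nonneg hp'_int hp'_one
  have hQ := aux_set m f p q ν hνs
  have hQ' := aux_set m f p' q ν' hνs'
  set Q' := quantQ m p' f q with hQ'def
  obtain ⟨a, ha⟩ := aux_nonempty ν q hq0 hq1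
  obtain ⟨a', ha'⟩ := aux_nonempty ν' q hq0 hq1
  have hbd' : BddAbove {u : ℝ | q ≤ ν'.real (Iic u) ∧ ν'.real (Iio u) ≤ q} := by
    obtain ⟨v, hv⟩ := aux_up ν' q hq1
    exact ⟨v, fun u hu => aux_le ν' q u v hv hu.2⟩
  have haQ : a' ≤ Q' := by rw [hQ']; exact le_csSup hbd' ha'
  have hgt : ∀ u, Q' < u → q < ν'.real (Iio u) := by
    intro u hu
    by_contra! hc
    have h1 : ν'.real (Iic a') ≤ ν'.real (Iic u) :=
      measureReal_mono (Iic_subset_Iic.2 (haQ.trans hu.le))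
    have : u ≤ Q' := by rw [hQ']; exact le_csSup hbd' ⟨ha'.1.trans h1, hc⟩
    linarith
  have hW : ∀ x, prefW m p' f q x * p x ≤ (f ⁻¹' Iic Q').indicator p x := by
    intro x
    have e1 : qle m p' f x = ν'.real (Iic (f x)) := hνs' _ measurableSet_Iic
    have e2 : qlt m p' f x = ν'.real (Iio (f x)) := hνs' _ measurableSet_Iio
    have e3 : ν'.real (Iio (f x)) ≤ ν'.real (Iic (f x)) := measureReal_mono Iio_subset_Iic_self
    unfold prefW
    rw [e1, e2]
    by_cases hx : f x ≤ Q'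
    · rw [indicator_of_mem (show x ∈ f ⁻¹' Iic Q' from hx)]
      refine mul_le_of_le_one_left (hp_nonneg x) ?_
      split_ifs with c1 c2
      · exact le_rfl
      · exact zero_le_one
      · have : 0 < ν'.real (Iic (f x)) - ν'.real (Iio (f x)) :=
          sub_pos.2 (lt_of_le_of_ne e3 (Ne.symm c1))
        rw [div_le_one this]
        rcases min_cases (ν'.real (Iic (f x))) q with h | h <;>
        rcases min_cases (ν'.real (Iio (f x))) q with h' | h' <;> linarith
    · rw [indicator_of_notMem (show x ∉ f ⁻¹' Iic Q' from hx)]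
      have h1 := hgt (f x) (not_le.1 hx)
      have h2 := h1.trans_le e3
      rw [if_neg (not_le.2 h2), min_eq_right h1.le, min_eq_right h2.le]
      simp
  have hI : Integrable (fun x => prefW m p' f q x * p x) m := by
    by_contra hc
    rw [integral_undef hc] at hJ
    linarith
  have hms : MeasurableSet (f ⁻¹' Iic Q') := hf measurableSet_Iic
  have h1 : ∫ x, prefW m p' f q x * p x ∂m ≤ ν.real (Iic Q') := by
    rw [← hνs _ measurableSet_Iic, ← integral_indicator hms]
    exact integral_mono hI (hp_int.indicator hms) hW
  have hat : ν.real {Q'} = 0 := by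
    rw [← hνs _ (measurableSet_singleton _)]; exact hatom
  have h2 : ν.real (Iic Q') ≤ ν.real (Iio Q') + ν.real {Q'} := by
    refine le_trans (measureReal_mono ?_) (measureReal_union_le _ _)
    intro x hx
    rcases lt_or_eq_of_le (show x ≤ Q' from hx) with h | h
    · exact Or.inl h
    · exact Or.inr h
  have h3 : ∃ v < Q', q < ν.real (Iic v) := by
    by_contra! hc
    have := aux_lim ν Q' q hc
    linarith
  obtain ⟨v, hv, hv'⟩ := h3
  rw [hQ]
  exact lt_of_le_of_lt (csSup_le ⟨a, ha⟩ fun u hu => aux_le ν q u v hv' hu.2) hv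
end
end

section
/- Let m be a σ-finite measure on a measurable space X, f : X → ℝ measurable, q ∈ (0,1), and let p be a probability density with respect to m with preference function W_p^f associated with the indicator weighting w(u) = 1_{u ≤ q}. Then W_p^f(x) = 0 for every x ∈ X with f(x) > Q_p^q(f); consequently, for every probability density p' with respect to m, ∫ W_p^f(x) p'(x) m(dx) ≤ P_{X∼p'}[f(X) ≤ Q_p^q(f)]. -/
open MeasureTheory Set

noncomputable section

variable {X : Type*} [MeasurableSpace X]

lemma aux_exists (ν : Measure ℝ) [IsProbabilityMeasure ν] (q : ℝ) (hq : q ∈ Ioo (0:ℝ) 1) :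
    (∃ u, q ≤ ν.real (Iic u) ∧ 1 - q ≤ ν.real (Ici u)) ∧
    BddAbove {u | q ≤ ν.real (Iic u) ∧ 1 - q ≤ ν.real (Ici u)} := by
  have hF : ∀ u, ν.real (Iic u) = ProbabilityTheory.cdf ν u :=
    fun u => (ProbabilityTheory.cdf_eq_real ν u).symm
  have hc : ∀ u, ν.real (Ici u) = 1 - ν.real (Iio u) := by
    intro u
    rw [← probReal_compl_eq_one_sub measurableSet_Iio, compl_Iio]
  obtain ⟨a, ha⟩ : ∃ a, ∀ u ≤ a, ProbabilityTheory.cdf ν u < q := by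
    have := (ProbabilityTheory.tendsto_cdf_atBot ν).eventually_lt_const hq.1
    exact Filter.eventually_atBot.1 this
  obtain ⟨b, hb⟩ : ∃ b, ∀ u ≥ b, q < ProbabilityTheory.cdf ν u := by
    have := (ProbabilityTheory.tendsto_cdf_atTop ν).eventually_const_lt hq.2
    exact Filter.eventually_atTop.1 this
  constructor
  · set T := {u | q ≤ ProbabilityTheory.cdf ν u} with hT
    have hTne : T.Nonempty := ⟨b, (hb b le_rfl).le⟩
    have hTb : BddBelow T := ⟨a, fun u hu => by
      by_contra h
      exact absurd (ha u (not_le.1 h).le) (not_lt.2 hu)⟩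
    refine ⟨sInf T, ?_, ?_⟩
    · rw [hF]
      have hr := (ProbabilityTheory.cdf ν).right_continuous (sInf T)
      have hr' := hr.mono_left (nhdsWithin_mono _ Ioi_subset_Ici_self)
      refine ge_of_tendsto hr' ?_
      filter_upwards [self_mem_nhdsWithin] with y hy
      obtain ⟨t, ht, hty⟩ := exists_lt_of_csInf_lt hTne hy
      exact le_trans ht (ProbabilityTheory.monotone_cdf ν hty.le)
    · rw [hc]
      have : ν.real (Iio (sInf T)) ≤ q := by
        have h1 : ν (Iio (sInf T)) =
            ENNReal.ofReal (Function.leftLim (ProbabilityTheory.cdf ν) (sInf T) - 0) := by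
          rw [← (ProbabilityTheory.cdf ν).measure_Iio (ProbabilityTheory.tendsto_cdf_atBot ν),
            ProbabilityTheory.measure_cdf]
        rw [Measure.real, h1]
        refine ENNReal.toReal_le_of_le_ofReal hq.1.le (ENNReal.ofReal_le_ofReal ?_)
        rw [sub_zero]
        refine le_of_tendsto ((ProbabilityTheory.monotone_cdf ν).tendsto_leftLim (sInf T)) ?_
        filter_upwards [self_mem_nhdsWithin] with y hy
        by_contra h
        exact absurd (csInf_le hTb (show y ∈ T from (not_le.1 h).le)) (not_le.2 hy)
      linarith
  · refine ⟨b, fun u hu => ?_⟩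
    by_contra h
    have h1 := hb b le_rfl
    rw [← hF] at h1
    have h2 : ν.real (Iic b) ≤ ν.real (Iio u) :=
      measureReal_mono (Iic_subset_Iio.2 (not_le.1 h))
    have h3 := hu.2
    rw [hc] at h3
    linarith

lemma aux_real (m : Measure X) (f : X → ℝ) (hf : Measurable f) (p : X → ℝ)
    (hp_nonneg : ∀ x, 0 ≤ p x) (hp_int : Integrable p m) (A : Set ℝ) (hA : MeasurableSet A) :
    ∫ x in f ⁻¹' A, p x ∂m =
      ((m.withDensity (fun x => ENNReal.ofReal (p x))).map f).real A := by
  rw [Measure.real, Measure.map_apply hf hA, withDensity_apply _ (hf hA),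
    integral_eq_lintegral_of_nonneg_ae (Filter.Eventually.of_forall hp_nonneg)
      hp_int.aestronglyMeasurable.restrict]

/-- The preference function vanishes above the quantile:
`W_p^f(x) = 0` whenever `f x > Q_p^q(f)`, and consequently for every
probability density `p'`, `∫ W_p^f p' dm ≤ P_{X∼p'}[f(X) ≤ Q_p^q(f)]`. -/
theorem pref_vanishes_above_quantile
    (m : Measure X) [SigmaFinite m]
    (f : X → ℝ) (hf : Measurable f) (q : ℝ) (hq : q ∈ Ioo (0:ℝ) 1)
    (p : X → ℝ)
    (hp_meas : Measurable p) (hp_nonneg : ∀ x, 0 ≤ p x)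
    (hp_int : Integrable p m) (hp_one : ∫ x, p x ∂m = 1) :
    (∀ x, quantQ m p f q < f x → prefW m p f q x = 0) ∧
      ∀ p' : X → ℝ, Measurable p' → (∀ x, 0 ≤ p' x) → Integrable p' m →
        (∫ x, p' x ∂m = 1) →
        ∫ x, prefW m p f q x * p' x ∂m
          ≤ ∫ x in {y | f y ≤ quantQ m p f q}, p' x ∂m := by
  set ν := (m.withDensity (fun x => ENNReal.ofReal (p x))).map f with hν
  have hR : ∀ A : Set ℝ, MeasurableSet A → ∫ x in f ⁻¹' A, p x ∂m = ν.real A :=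
    fun A hA => aux_real m f hf p hp_nonneg hp_int A hA
  have hprob : IsProbabilityMeasure ν := by
    constructor
    have h := hR univ MeasurableSet.univ
    rw [preimage_univ, setIntegral_univ, hp_one, Measure.real] at h
    exact (ENNReal.toReal_eq_one_iff _).1 h.symm
  obtain ⟨hne, hbd⟩ := aux_exists ν q hq
  have hle : ∀ x, qle m p f x = ν.real (Iic (f x)) := fun x => hR _ measurableSet_Iic
  have hlt : ∀ x, qlt m p f x = ν.real (Iio (f x)) := fun x => hR _ measurableSet_Iio
  have hQ : quantQ m p f q = sSup {u | q ≤ ν.real (Iic u) ∧ 1 - q ≤ ν.real (Ici u)} := by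
    have h1 : ∀ u, probLe m p f u = ν.real (Iic u) := fun u => hR _ measurableSet_Iic
    have h2 : ∀ u, probGe m p f u = ν.real (Ici u) := fun u => hR _ measurableSet_Ici
    simp only [quantQ, h1, h2]
  have hmono : ∀ x, qlt m p f x ≤ qle m p f x := fun x => by
    rw [hle, hlt]
    exact measureReal_mono Iio_subset_Iic_self
  have hzero : ∀ x, quantQ m p f q < f x → prefW m p f q x = 0 := by
    intro x hx
    rw [hQ] at hx
    have hgt : q < qlt m p f x := by
      obtain ⟨u, hu⟩ := hne
      have hux : u < f x := (le_csSup hbd hu).trans_lt hx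
      have h1 : q ≤ ν.real (Iic (f x)) := hu.1.trans (measureReal_mono (Iic_subset_Iic.2 hux.le))
      have h2 : ν.real (Ici (f x)) < 1 - q := by
        by_contra h
        exact absurd (le_csSup hbd ⟨h1, not_lt.1 h⟩) (not_le.2 hx)
      rw [← compl_Iio, probReal_compl_eq_one_sub measurableSet_Iio] at h2
      rw [hlt]
      linarith
    have h := hmono x
    unfold prefW
    rw [min_eq_right (hgt.le.trans h), min_eq_right hgt.le, if_neg (not_le.2 (hgt.trans_le h))]
    simp
  have hW0 : ∀ x, 0 ≤ prefW m p f q x := by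
    intro x
    have h := hmono x
    unfold prefW
    split_ifs
    · exact zero_le_one
    · exact le_rfl
    · exact div_nonneg (sub_nonneg.2 (min_le_min_right _ h)) (sub_nonneg.2 h)
  have hW1 : ∀ x, prefW m p f q x ≤ 1 := by
    intro x
    have h := hmono x
    unfold prefW
    split_ifs
    · exact le_rfl
    · exact zero_le_one
    · refine div_le_one_of_le₀ ?_ (sub_nonneg.2 h)
      rcases min_cases (qle m p f x) q with h1 | h1 <;>
      rcases min_cases (qlt m p f x) q with h2 | h2 <;> linarith
  refine ⟨hzero, fun p' _ hp0 hpi _ => ?_⟩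
  have hA : MeasurableSet {y | f y ≤ quantQ m p f q} := hf measurableSet_Iic
  rw [← integral_indicator hA]
  refine integral_mono_of_nonneg
    (Filter.Eventually.of_forall fun x => mul_nonneg (hW0 x) (hp0 x)) (hpi.indicator hA)
    (Filter.Eventually.of_forall fun x => ?_)
  by_cases hx : f x ≤ quantQ m p f q
  · simp only [indicator, mem_setOf_eq, hx, if_true]
    exact mul_le_of_le_one_left (hp0 x) (hW1 x)
  · simp [indicator, hx, hzero x (not_le.1 hx)]
end
end

section
/- Let m be a σ-finite measure on a measurable space X, f : X → ℝ measurable, q ∈ (0,1), and let p_k and p_{k+1} be probability densities with respect to m. Let W_{p_k}^f be the preference function associated with p_k and the indicator weighting w(u) = 1_{u ≤ q}. Let F(u) = P_{X∼p_{k+1}}[f(X) ≤ u] and suppose F is continuous and strictly increasing on the range of f (hence a bijection from the range of f, an interval, onto [0,1]). Let Δ ∈ ℝ be such that ∫ W_{p_k}^f(x) p_{k+1}(x) m(dx) ≥ exp(Δ) q and exp(Δ) · F(Q_{p_{k+1}}^q(f)) ∈ [0,1]. Then F(Q_{p_k}^q(f)) ≥ exp(Δ) · F(Q_{p_{k+1}}^q(f)),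 and therefore Q_{p_k}^q(f) ≥ F^{−1}(exp(Δ) · F(Q_{p_{k+1}}^q(f))). -/
open MeasureTheory Set

noncomputable section

variable {X : Type*} [MeasurableSpace X]

lemma law_quantile (ν : Measure ℝ) [IsProbabilityMeasure ν] (q : ℝ) (hq : q ∈ Ioo (0:ℝ) 1) :
    ∃ u₀, q ≤ ν.real (Iic u₀) ∧ ν.real (Iio u₀) ≤ q ∧ ∀ u, u₀ < u → q < ν.real (Iio u) := by
  have hG := ProbabilityTheory.cdf_eq_real ν
  have hmono := ProbabilityTheory.monotone_cdf ν
  set G := ProbabilityTheory.cdf ν with hGdef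
  set A : Set ℝ := {u | q < G u} with hA
  have hne : A.Nonempty :=
    ((ProbabilityTheory.tendsto_cdf_atTop ν).eventually (lt_mem_nhds hq.2)).exists
  have hbdd : BddBelow A := by
    obtain ⟨b, hb⟩ :=
      ((ProbabilityTheory.tendsto_cdf_atBot ν).eventually (gt_mem_nhds hq.1)).exists
    refine ⟨b, fun u hu => ?_⟩
    by_contra h
    have h1 : G u ≤ G b := hmono (not_le.mp h).le
    have h2 : q < G u := hu
    have h3 : G b < q := hb
    linarith
  have hlow : ∀ u, u < sInf A → G u ≤ q := fun u hu => by
    by_contra h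
    exact absurd (csInf_le hbdd (show u ∈ A from not_le.mp h)) (not_le.mpr hu)
  have hhigh : ∀ u, sInf A < u → ∃ w, w < u ∧ q < G w := fun u hu => by
    obtain ⟨w, hw, hwu⟩ := exists_lt_of_csInf_lt hne hu
    exact ⟨w, hwu, hw⟩
  refine ⟨sInf A, ?_, ?_, ?_⟩
  · rw [← hG]
    have hr : Filter.Tendsto G (nhdsWithin (sInf A) (Ioi (sInf A))) (nhds (G (sInf A))) :=
      (G.right_continuous (sInf A)).mono_left (nhdsWithin_mono _ Ioi_subset_Ici_self)
    refine ge_of_tendsto hr ?_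
    filter_upwards [self_mem_nhdsWithin] with u hu
    obtain ⟨w, hw, hqw⟩ := hhigh u hu
    exact hqw.le.trans (hmono hw.le)
  · have h1 : ν (Iio (sInf A)) = ENNReal.ofReal (Function.leftLim G (sInf A) - 0) := by
      conv_lhs => rw [← ProbabilityTheory.measure_cdf ν]
      exact G.measure_Iio (ProbabilityTheory.tendsto_cdf_atBot ν) _
    rw [measureReal_def, h1, sub_zero]
    refine ENNReal.toReal_le_of_le_ofReal hq.1.le (ENNReal.ofReal_le_ofReal ?_)
    refine le_of_tendsto (hmono.tendsto_leftLim (sInf A)) ?_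
    filter_upwards [self_mem_nhdsWithin] with u hu using hlow u hu
  · intro u hu
    obtain ⟨w, hw, hqw⟩ := hhigh u hu
    rw [hG] at hqw
    exact hqw.trans_le (measureReal_mono (fun x hx => lt_of_le_of_lt hx hw))

lemma quant_props (m : Measure X) (f : X → ℝ) (hf : Measurable f) (q : ℝ)
    (hq : q ∈ Ioo (0:ℝ) 1) (p : X → ℝ) (h0 : ∀ x, 0 ≤ p x)
    (hi : Integrable p m) (h1 : ∫ x, p x ∂m = 1) :
    q ≤ probLe m p f (quantQ m p f q) ∧
    (∫ x in {y | f y < quantQ m p f q}, p x ∂m) ≤ q ∧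
    ∀ u, quantQ m p f q < u → q < ∫ x in {y | f y < u}, p x ∂m := by
  set μ := m.withDensity (fun x => ENNReal.ofReal (p x)) with hμ
  have hreal : ∀ s, MeasurableSet s → μ.real s = ∫ x in s, p x ∂m := by
    intro s hs
    rw [measureReal_def, hμ, withDensity_apply _ hs,
      ← ofReal_integral_eq_lintegral_ofReal hi.restrict (ae_of_all _ h0),
      ENNReal.toReal_ofReal (integral_nonneg h0)]
  have hprob : IsProbabilityMeasure μ := by
    constructor
    rw [hμ, withDensity_apply _ MeasurableSet.univ, Measure.restrict_univ,
      ← ofReal_integral_eq_lintegral_ofReal hi (ae_of_all _ h0), h1, ENNReal.ofReal_one]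
  have hprob' : IsProbabilityMeasure (μ.map f) :=
    Measure.isProbabilityMeasure_map hf.aemeasurable
  have hle : ∀ u, (μ.map f).real (Iic u) = probLe m p f u := fun u => by
    rw [map_measureReal_apply hf measurableSet_Iic, hreal _ (hf measurableSet_Iic)]; rfl
  have hlt : ∀ u, (μ.map f).real (Iio u) = ∫ x in {y | f y < u}, p x ∂m := fun u => by
    rw [map_measureReal_apply hf measurableSet_Iio, hreal _ (hf measurableSet_Iio)]; rfl
  have hge : ∀ u, probGe m p f u = 1 - ∫ x in {y | f y < u}, p x ∂m := fun u => by
    have := integral_add_compl (s := {y | f y < u}) (hf measurableSet_Iio) hi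
    have hc : {y | f y < u}ᶜ = {y | u ≤ f y} := by ext y; simp
    rw [hc, h1] at this
    unfold probGe
    linarith
  obtain ⟨u₀, a, b, c⟩ := law_quantile (μ.map f) q hq
  simp only [hle, hlt] at a b c
  have hQ : quantQ m p f q = u₀ := by
    apply IsGreatest.csSup_eq
    refine ⟨⟨a, by rw [hge]; linarith⟩, fun u hu => ?_⟩
    by_contra h
    have := c u (not_le.mp h)
    have h2 := hu.2
    rw [hge] at h2
    linarith
  rw [hQ]
  exact ⟨a, b, c⟩

lemma setInt_mono (m : Measure X) (p : X → ℝ) (h0 : ∀ x, 0 ≤ p x)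
    (hi : Integrable p m) {s t : Set X} (hst : s ⊆ t) :
    ∫ x in s, p x ∂m ≤ ∫ x in t, p x ∂m :=
  setIntegral_mono_set hi.integrableOn (ae_of_all _ h0) (Filter.Eventually.of_forall hst)

/-- **Quantitative quantile improvement (Proposition 3).** If
`∫ W_{p_k}^f p_{k+1} dm ≥ exp Δ · q`, with `F` the c.d.f. of `f` under `p_{k+1}`
continuous, strictly increasing, and a bijection from the range of `f` onto `[0,1]`
with inverse `Finv`, and `exp Δ · F(Q_{p_{k+1}}^q(f)) ∈ [0,1]`, then
`F(Q_{p_k}^q(f)) ≥ exp Δ · F(Q_{p_{k+1}}^q(f))` and hence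
`Q_{p_k}^q(f) ≥ F⁻¹(exp Δ · F(Q_{p_{k+1}}^q(f)))`. -/
theorem quantile_improvement_quantitative
    (m : Measure X) [SigmaFinite m]
    (f : X → ℝ) (hf : Measurable f) (q : ℝ) (hq : q ∈ Ioo (0:ℝ) 1)
    (pk pk1 : X → ℝ)
    (hpk_meas : Measurable pk) (hpk_nonneg : ∀ x, 0 ≤ pk x)
    (hpk_int : Integrable pk m) (hpk_one : ∫ x, pk x ∂m = 1)
    (hpk1_meas : Measurable pk1) (hpk1_nonneg : ∀ x, 0 ≤ pk1 x)
    (hpk1_int : Integrable pk1 m) (hpk1_one : ∫ x, pk1 x ∂m = 1)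
    (F : ℝ → ℝ) (hF : ∀ u, F u = probLe m pk1 f u)
    (hFcont : ContinuousOn F (Set.range f))
    (hFmono : StrictMonoOn F (Set.range f))
    (hFbij : Set.BijOn F (Set.range f) (Set.Icc 0 1))
    (Finv : ℝ → ℝ)
    (hFinv : Set.InvOn Finv F (Set.range f) (Set.Icc 0 1))
    (hFinvMaps : Set.MapsTo Finv (Set.Icc 0 1) (Set.range f))
    (Δ : ℝ)
    (hJ : Real.exp Δ * q ≤ ∫ x, prefW m pk f q x * pk1 x ∂m)
    (hin : Real.exp Δ * F (quantQ m pk1 f q) ∈ Set.Icc (0:ℝ) 1) :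
    Real.exp Δ * F (quantQ m pk1 f q) ≤ F (quantQ m pk f q) ∧
      Finv (Real.exp Δ * F (quantQ m pk1 f q)) ≤ quantQ m pk f q := by
  obtain ⟨ka, kb, kc⟩ := quant_props m f hf q hq pk hpk_nonneg hpk_int hpk_one
  obtain ⟨_, nb, _⟩ := quant_props m f hf q hq pk1 hpk1_nonneg hpk1_int hpk1_one
  have hFm : Monotone F := fun u v huv => by
    rw [hF, hF]
    exact setInt_mono m pk1 hpk1_nonneg hpk1_int (fun x hx => le_trans hx huv)
  have hF1 : ∀ u, F u ≤ 1 := fun u => by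
    rw [hF, ← hpk1_one]
    exact setIntegral_le_integral hpk1_int (ae_of_all _ hpk1_nonneg)
  have hQ1 : F (quantQ m pk1 f q) ≤ q := by
    by_contra h
    obtain ⟨t, ht1, ht2⟩ := exists_between (not_le.mp h)
    obtain ⟨w, _, hw⟩ := hFbij.surjOn
      (show t ∈ Icc (0:ℝ) 1 from ⟨(hq.1.trans ht1).le, ht2.le.trans (hF1 _)⟩)
    rcases lt_or_ge w (quantQ m pk1 f q) with hlt | hge
    · have : F w ≤ q := by
        rw [hF]
        refine le_trans ?_ nb
        exact setInt_mono m pk1 hpk1_nonneg hpk1_int (fun x hx => lt_of_le_of_lt hx hlt)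
      linarith
    · have := hFm hge
      linarith
  have hJ2 : ∫ x, prefW m pk f q x * pk1 x ∂m ≤ F (quantQ m pk f q) := by
    rw [hF]
    have hms : MeasurableSet {y | f y ≤ quantQ m pk f q} := hf measurableSet_Iic
    unfold probLe
    rw [← integral_indicator hms]
    have hqq : ∀ x, qlt m pk f x ≤ qle m pk f x := fun x =>
      setInt_mono m pk hpk_nonneg hpk_int (fun y (hy : f y < f x) => show f y ≤ f x from hy.le)
    have hW0 : ∀ x, 0 ≤ prefW m pk f q x := fun x => by
      have := hqq x
      unfold prefW
      split_ifs with h h'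
      · exact zero_le_one
      · exact le_rfl
      · exact div_nonneg (sub_nonneg.mpr (min_le_min_right _ this)) (sub_nonneg.mpr this)
    have hW1 : ∀ x, prefW m pk f q x ≤ 1 := fun x => by
      have := hqq x
      unfold prefW
      split_ifs with h h'
      · exact le_rfl
      · exact zero_le_one
      · refine div_le_one_of_le₀ ?_ (sub_nonneg.mpr this)
        rcases le_total (qle m pk f x) q with h1 | h1 <;>
          rcases le_total (qlt m pk f x) q with h2 | h2 <;> simp [h1, h2] <;> linarith
    have hWz : ∀ x, quantQ m pk f q < f x → prefW m pk f q x = 0 := fun x hx => by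
      have h1 : q < qlt m pk f x := kc _ hx
      have h2 : q < qle m pk f x := h1.trans_le (hqq x)
      unfold prefW
      rw [if_neg (not_le.mpr h2), min_eq_right h1.le, min_eq_right h2.le]
      simp
    refine integral_mono_of_nonneg (ae_of_all _ fun x => mul_nonneg (hW0 x) (hpk1_nonneg x))
      (hpk1_int.indicator hms) (ae_of_all _ fun x => ?_)
    by_cases hx : f x ≤ quantQ m pk f q
    · have hx' : x ∈ {y | f y ≤ quantQ m pk f q} := hx
      simp only [Set.indicator_of_mem hx']
      exact mul_le_of_le_one_left (hpk1_nonneg x) (hW1 x)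
    · have hx' : x ∉ {y | f y ≤ quantQ m pk f q} := hx
      simp only [Set.indicator_of_notMem hx', hWz x (not_le.mp hx), zero_mul, le_refl]
  have hmain : Real.exp Δ * F (quantQ m pk1 f q) ≤ F (quantQ m pk f q) :=
    (mul_le_mul_of_nonneg_left hQ1 (Real.exp_pos Δ).le).trans (hJ.trans hJ2)
  refine ⟨hmain, ?_⟩
  have hv := hFinvMaps hin
  have hFv := hFinv.2 hin
  set v := Finv (Real.exp Δ * F (quantQ m pk1 f q))
  by_contra hlt
  have hlt := not_le.mp hlt
  have hsub : {y | f y < v} ⊆ {y | f y < quantQ m pk f q} := fun y hy => by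
    by_contra h
    have h1 : F (f y) < F v := hFmono ⟨y, rfl⟩ hv hy
    have h2 := hFm (not_lt.mp h)
    linarith
  have h3 := setInt_mono m pk hpk_nonneg hpk_int hsub
  have h4 := kc v hlt
  linarith
end
end

section
/- Let m be a σ-finite measure on a measurable space X, h : X → [0,∞) and Γ : X → ℝ^n measurable, and define the log-partition function A(θ) = ln ∫ h(x) exp(⟨θ, Γ(x)⟩) m(dx) on Θ = {θ ∈ ℝ^n : A(θ) < ∞}, with exponential family densities p_θ(x) = h(x) exp(⟨θ, Γ(x)⟩ − A(θ)). Assume A is convex on Θ and differentiable at interior points θ_k and θ_{k+1} of Θ, with ∇A(θ) = ∫ Γ(x) p_θ(x) m(dx) at these points. Let W : X → [0,∞) be measurable with Z := ∫ W(x) p_{θ_k}(x) m(dx) ∈ (0,∞), set π = W p_{θ_k}/Z, and assume ∫ ‖Γ(x)‖ π(x) m(dx) < ∞ and KL(π, p_θ) < ∞ for all θ ∈ Θ. Let τ > 0 with τZ ≤ 1, and suppose the IGO update holds: ∇A(θ_{k+1}) = ∇A(θ_k) + τ ∫ W(x) (Γ(x) − ∇A(θ_k)) p_{θ_k}(x)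 m(dx). Then KL(π, p_{θ_{k+1}}) + ((1 − τZ)/(τZ)) · KL(p_{θ_k}, p_{θ_{k+1}}) ≤ KL(π, p_{θ_k}). -/
open MeasureTheory Set
open scoped RealInnerProductSpace

noncomputable section

lemma igo_grad_ineq {E : Type*} [NormedAddCommGroup E] [InnerProductSpace ℝ E] [CompleteSpace E]
    {S : Set E} {A : E → ℝ} (hc : ConvexOn ℝ S A) {a b g : E} (ha : a ∈ S) (hb : b ∈ S)
    (hg : HasGradientAt A g a) : A a + ⟪g, b - a⟫ ≤ A b := by
  have h1 := hc.comp_affineMap (AffineMap.lineMap a b : ℝ →ᵃ[ℝ] E)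
  have h2 : HasDerivAt (fun t : ℝ => (AffineMap.lineMap a b : ℝ →ᵃ[ℝ] E) t) (b - a) 0 :=
    AffineMap.hasDerivAt_lineMap
  have h3 : HasDerivAt (A ∘ (AffineMap.lineMap a b : ℝ →ᵃ[ℝ] E)) ⟪g, b - a⟫ 0 := by
    have h4 := hg.hasFDerivAt
    have h5 : a = (AffineMap.lineMap a b : ℝ →ᵃ[ℝ] E) (0 : ℝ) := by simp
    rw [h5] at h4
    have := h4.comp_hasDerivAt (0 : ℝ) h2
    simpa using this
  have := h1.le_slope_of_hasDerivAt (x := 0) (y := 1) (by simpa using ha) (by simpa using hb)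
    one_pos h3
  simp [slope_def_field] at this
  linarith

lemma igo_integrable {X : Type*} [MeasurableSpace X] {n : ℕ} (m : Measure X)
    (h : X → ℝ) (hh_meas : Measurable h) (hh_nonneg : ∀ x, 0 ≤ h x)
    (Γ : X → EuclideanSpace ℝ (Fin n)) (hΓ_meas : Measurable Γ) (θ : EuclideanSpace ℝ (Fin n))
    (hθ : ∫⁻ x, ENNReal.ofReal (h x * Real.exp ⟪θ, Γ x⟫) ∂m < ⊤) :
    Integrable (fun x => h x * Real.exp ⟪θ, Γ x⟫) m := by
  refine ⟨by fun_prop, ?_⟩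
  rw [hasFiniteIntegral_iff_ofReal]
  · exact hθ
  · exact Filter.Eventually.of_forall fun x => mul_nonneg (hh_nonneg x) (Real.exp_pos _).le

lemma igo_integrable_smul {X : Type*} [MeasurableSpace X] {n : ℕ} (m : Measure X)
    (h : X → ℝ) (hh_meas : Measurable h) (hh_nonneg : ∀ x, 0 ≤ h x)
    (Γ : X → EuclideanSpace ℝ (Fin n)) (hΓ_meas : Measurable Γ) (θ : EuclideanSpace ℝ (Fin n))
    (hθ : θ ∈ interior {θ | ∫⁻ x, ENNReal.ofReal (h x * Real.exp ⟪θ, Γ x⟫) ∂m < ⊤}) :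
    Integrable (fun x => (h x * Real.exp ⟪θ, Γ x⟫) • Γ x) m := by
  rw [integrable_piLp_iff]
  intro i
  obtain ⟨r, hr, hball⟩ := Metric.mem_nhds_iff.1 (mem_interior_iff_mem_nhds.1 hθ)
  set e : EuclideanSpace ℝ (Fin n) := EuclideanSpace.single i (1 : ℝ) with he
  have hin : ∀ x, ⟪e, Γ x⟫ = Γ x i := fun x => by simp [he, EuclideanSpace.inner_single_left]
  have hne : ‖e‖ = 1 := by simp [he]
  have hP : Integrable (fun x => h x * Real.exp ⟪θ + (r/2) • e, Γ x⟫) m := by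
    apply igo_integrable m h hh_meas hh_nonneg Γ hΓ_meas
    apply hball
    simp [norm_smul, hne, abs_of_pos hr]; linarith
  have hM : Integrable (fun x => h x * Real.exp ⟪θ - (r/2) • e, Γ x⟫) m := by
    apply igo_integrable m h hh_meas hh_nonneg Γ hΓ_meas
    apply hball
    simp [norm_smul, hne, abs_of_pos hr, dist_eq_norm]; linarith
  refine ((hP.add hM).const_mul (2 / r)).mono' (by
    exact Measurable.aestronglyMeasurable (by
      simp only [PiLp.smul_apply, ← hin]
      fun_prop)) ?_
  refine Filter.Eventually.of_forall fun x => ?_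
  simp only [Pi.add_apply, inner_add_left, inner_sub_left, real_inner_smul_left, hin,
    PiLp.smul_apply, smul_eq_mul, norm_mul, Real.norm_eq_abs, abs_of_nonneg (hh_nonneg x),
    Real.abs_exp]
  rw [Real.exp_add, sub_eq_add_neg, Real.exp_add]
  have h1 : r / 2 * |Γ x i| ≤ Real.exp (r / 2 * Γ x i) + Real.exp (-(r / 2 * Γ x i)) := by
    have a1 := Real.add_one_le_exp (r / 2 * Γ x i)
    have a2 := Real.add_one_le_exp (-(r / 2 * Γ x i))
    have a3 := Real.exp_pos (r / 2 * Γ x i)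
    have a4 := Real.exp_pos (-(r / 2 * Γ x i))
    rcases abs_cases (Γ x i) with ⟨q, _⟩ | ⟨q, _⟩ <;> rw [q] <;> linarith
  have h2 := mul_le_mul_of_nonneg_left h1
    (mul_nonneg (hh_nonneg x) (Real.exp_pos ⟪θ, Γ x⟫).le)
  have h3 := mul_le_mul_of_nonneg_left h2 (show 0 ≤ 2 / r by positivity)
  calc _ = 2 / r * (h x * Real.exp ⟪θ, Γ x⟫ * (r / 2 * |Γ x i|)) := by field_simp
    _ ≤ _ := h3
    _ = _ := by ring

/-- **Proposition 5 (ii): IGO natural-gradient update over an exponential family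
achieves a quantified KL decrease.** If the exponential-family IGO update
`∇A(θ_{k+1}) = ∇A(θ_k) + τ ∫ W (Γ - ∇A(θ_k)) p_{θ_k} dm` holds with `0 < τ`, `τZ ≤ 1`,
then `KL(π, p_{θ_{k+1}}) + ((1-τZ)/(τZ)) KL(p_{θ_k}, p_{θ_{k+1}}) ≤ KL(π, p_{θ_k})`. -/
theorem igo_exponential_family_KL_decrease
    {X : Type*} [MeasurableSpace X] {n : ℕ} (m : Measure X) [SigmaFinite m]
    (h : X → ℝ) (hh_meas : Measurable h) (hh_nonneg : ∀ x, 0 ≤ h x)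
    (Γ : X → EuclideanSpace ℝ (Fin n)) (hΓ_meas : Measurable Γ)
    (A : EuclideanSpace ℝ (Fin n) → ℝ)
    (hA : ∀ θ, A θ =
      Real.log ((∫⁻ x, ENNReal.ofReal (h x * Real.exp ⟪θ, Γ x⟫) ∂m).toReal))
    (Θ : Set (EuclideanSpace ℝ (Fin n)))
    (hΘ : Θ = {θ | ∫⁻ x, ENNReal.ofReal (h x * Real.exp ⟪θ, Γ x⟫) ∂m < ⊤})
    (p : EuclideanSpace ℝ (Fin n) → X → ℝ)
    (hp : ∀ θ x, p θ x = h x * Real.exp (⟪θ, Γ x⟫ - A θ))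
    (hA_conv : ConvexOn ℝ Θ A)
    (θk θk1 : EuclideanSpace ℝ (Fin n))
    (hθk : θk ∈ interior Θ) (hθk1 : θk1 ∈ interior Θ)
    (gk gk1 : EuclideanSpace ℝ (Fin n))
    (hgk : HasGradientAt A gk θk) (hgk1 : HasGradientAt A gk1 θk1)
    (hgk_eq : gk = ∫ x, p θk x • Γ x ∂m)
    (hgk1_eq : gk1 = ∫ x, p θk1 x • Γ x ∂m)
    (W : X → ℝ) (hW_meas : Measurable W) (hW_nonneg : ∀ x, 0 ≤ W x)
    (Z : ℝ) (hZ : Z = ∫ x, W x * p θk x ∂m) (hZ_pos : 0 < Z)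
    (hZ_int : Integrable (fun x => W x * p θk x) m)
    (π : X → ℝ) (hπ : ∀ x, π x = W x * p θk x / Z)
    (hΓπ_int : Integrable (fun x => π x • Γ x) m)
    (hKL_fin : ∀ θ ∈ Θ, Integrable (fun x => π x * Real.log (π x / p θ x)) m)
    (τ : ℝ) (hτ_pos : 0 < τ) (hτZ : τ * Z ≤ 1)
    (hupdate : gk1 = gk + τ • ∫ x, (W x * p θk x) • (Γ x - gk) ∂m) :
    (∫ x, π x * Real.log (π x / p θk1 x) ∂m)
        + ((1 - τ * Z) / (τ * Z)) * ∫ x, p θk x * Real.log (p θk x / p θk1 x) ∂m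
      ≤ ∫ x, π x * Real.log (π x / p θk x) ∂m := by
  subst hΘ
  have hk := interior_subset hθk
  have hk1 := interior_subset hθk1
  -- integrability of the family density at θk
  have hI := igo_integrable m h hh_meas hh_nonneg Γ hΓ_meas θk hk
  have hIΓ := igo_integrable_smul m h hh_meas hh_nonneg Γ hΓ_meas θk hθk
  have hpk : ∀ x, p θk x = Real.exp (-A θk) * (h x * Real.exp ⟪θk, Γ x⟫) := fun x => by
    rw [hp, sub_eq_add_neg, Real.exp_add]; ring
  have hpI : Integrable (p θk) m := by
    rw [funext hpk]; exact hI.const_mul _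
  have hpIΓ : Integrable (fun x => p θk x • Γ x) m := by
    refine (hIΓ.smul (Real.exp (-A θk))).congr (Filter.Eventually.of_forall fun x => ?_)
    simp only [Pi.smul_apply, hpk, mul_smul]
  have hS : (∫⁻ x, ENNReal.ofReal (h x * Real.exp ⟪θk, Γ x⟫) ∂m).toReal
      = ∫ x, h x * Real.exp ⟪θk, Γ x⟫ ∂m := by
    rw [integral_eq_lintegral_of_nonneg_ae _ hI.1]
    exact Filter.Eventually.of_forall fun x => mul_nonneg (hh_nonneg x) (Real.exp_pos _).le
  have hSpos : 0 < ∫ x, h x * Real.exp ⟪θk, Γ x⟫ ∂m := by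
    have hnn : 0 ≤ fun x => h x * Real.exp ⟪θk, Γ x⟫ :=
      fun x => mul_nonneg (hh_nonneg x) (Real.exp_pos _).le
    refine lt_of_le_of_ne (integral_nonneg hnn) fun h0 => ?_
    have h1 := (integral_eq_zero_iff_of_nonneg hnn hI).1 h0.symm
    have : Z = 0 := by
      rw [hZ]
      apply integral_eq_zero_of_ae
      filter_upwards [h1] with x hx
      have hx' : h x * Real.exp ⟪θk, Γ x⟫ = 0 := hx
      simp [hpk, hx']
    linarith
  have hp1 : ∫ x, p θk x ∂m = 1 := by
    simp only [hpk]
    rw [integral_const_mul, hA, hS, Real.exp_neg, Real.exp_log hSpos]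
    exact inv_mul_cancel₀ hSpos.ne'
  have hπI : Integrable π m := by
    rw [funext hπ]; exact hZ_int.div_const _
  have hπ1 : ∫ x, π x ∂m = 1 := by
    simp only [hπ]
    rw [integral_div, ← hZ, div_self hZ_pos.ne']
  set δ := θk1 - θk with hδ
  set a := A θk1 - A θk with ha
  have hin : ∀ f : X → ℝ, Integrable (fun x => f x • Γ x) m →
      Integrable (fun x => f x * ⟪δ, Γ x⟫) m ∧
      ∫ x, f x * ⟪δ, Γ x⟫ ∂m = ⟪δ, ∫ x, f x • Γ x ∂m⟫ := fun f hf => by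
    have e : (fun x => f x * ⟪δ, Γ x⟫) = fun x => ⟪δ, f x • Γ x⟫ := by
      funext x; rw [real_inner_smul_right]
    rw [e]
    exact ⟨hf.const_inner δ, integral_inner hf δ⟩
  set E := ∫ x, π x • Γ x ∂m with hE
  -- difference of the two KL terms
  have hD : (∫ x, π x * Real.log (π x / p θk x) ∂m) - ∫ x, π x * Real.log (π x / p θk1 x) ∂m
      = ⟪δ, E⟫ - a := by
    rw [← integral_sub (hKL_fin _ hk) (hKL_fin _ hk1)]
    have : (fun x => π x * Real.log (π x / p θk x) - π x * Real.log (π x / p θk1 x))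
        = fun x => π x * ⟪δ, Γ x⟫ - π x * a := by
      funext x
      by_cases h0 : π x = 0
      · simp [h0]
      have hx : h x ≠ 0 := fun h1 => h0 (by rw [hπ, hp, h1]; simp)
      have q : ∀ θ, p θ x ≠ 0 := fun θ => by rw [hp]; exact mul_ne_zero hx (Real.exp_ne_zero _)
      rw [Real.log_div h0 (q _), Real.log_div h0 (q _), hp, hp,
        Real.log_mul hx (Real.exp_ne_zero _), Real.log_mul hx (Real.exp_ne_zero _),
        Real.log_exp, Real.log_exp, hδ, ha, inner_sub_left]
      ring
    rw [this, integral_sub (hin π hΓπ_int).1 (hπI.mul_const a), (hin π hΓπ_int).2,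
      integral_mul_const, hπ1, one_mul]
  have hK : ∫ x, p θk x * Real.log (p θk x / p θk1 x) ∂m = a - ⟪δ, gk⟫ := by
    have : (fun x => p θk x * Real.log (p θk x / p θk1 x))
        = fun x => p θk x * a - p θk x * ⟪δ, Γ x⟫ := by
      funext x
      by_cases hx : h x = 0
      · simp [hp, hx]
      have q : ∀ θ, p θ x ≠ 0 := fun θ => by rw [hp]; exact mul_ne_zero hx (Real.exp_ne_zero _)
      have : Real.log (p θk x / p θk1 x) = a - ⟪δ, Γ x⟫ := by
        rw [Real.log_div (q _) (q _), hp, hp,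
          Real.log_mul hx (Real.exp_ne_zero _), Real.log_mul hx (Real.exp_ne_zero _),
          Real.log_exp, Real.log_exp, hδ, ha, inner_sub_left]
        ring
      rw [this]; ring
    rw [this, integral_sub (hpI.mul_const a) (hin _ hpIΓ).1, (hin _ hpIΓ).2,
      integral_mul_const, hp1, one_mul, ← hgk_eq]
  have hU : gk1 = gk + (τ * Z) • (E - gk) := by
    have hWp : ∀ x, W x * p θk x = Z * π x := fun x => by
      rw [hπ]; field_simp
    rw [hupdate]
    simp only [hWp, mul_smul]
    rw [integral_smul]
    simp only [smul_sub (π _)]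
    rw [integral_sub hΓπ_int (hπI.smul_const gk), integral_smul_const, hπ1, one_smul]
  have hG := igo_grad_ineq hA_conv hk1 hk hgk1
  have hG' : 0 ≤ ⟪δ, gk1⟫ - a := by
    have : ⟪gk1, θk - θk1⟫ = -⟪δ, gk1⟫ := by
      rw [hδ, ← inner_neg_left, neg_sub, real_inner_comm]
    rw [this] at hG
    rw [ha]; linarith
  rw [hU, inner_add_right, real_inner_smul_right, inner_sub_right] at hG'
  rw [hK]
  have hc : 0 < τ * Z := by positivity
  set c := τ * Z
  have key : (⟪δ, E⟫ - a) - (1 - c) / c * (a - ⟪δ, gk⟫)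
      = (1 / c) * (⟪δ, gk⟫ + c * (⟪δ, E⟫ - ⟪δ, gk⟫) - a) := by
    field_simp
    ring
  have : 0 ≤ (1 / c) * (⟪δ, gk⟫ + c * (⟪δ, E⟫ - ⟪δ, gk⟫) - a) :=
    mul_nonneg (by positivity) hG'
  linarith
end
end

section
/- Let m be a σ-finite measure on a measurable space X, let {p_θ}_{θ ∈ Θ} be a family of probability densities with respect to m with p_θ(x) > 0 for all x, and fix θ_k ∈ Θ. Let W : X → [0,∞) be measurable with Z := ∫ W(x) p_{θ_k}(x) m(dx) ∈ (0,∞), set π = W p_{θ_k}/Z, and let τ ∈ (0,1]. Assume that all integrals below are finite and that θ_{k+1} maximizes over Θ the IGO-ML objective θ ↦ (1−τ) ∫ ln(p_θ(x)) p_{θ_k}(x) m(dx) + τ ∫ W(x) ln(p_θ(x)) p_{θ_k}(x) m(dx). Then KL(π, p_{θ_{k+1}}) + ((1−τ)/(τZ)) · KL(p_{θ_k}, p_{θ_{k+1}}) ≤ KL(π, p_{θ_k}). -/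
open MeasureTheory Set

noncomputable section

/-- **Proposition 5 (iii): the IGO-ML update achieves a quantified KL decrease.**
If `θ_{k+1}` maximizes `θ ↦ (1-τ) ∫ ln(p_θ) p_{θ_k} dm + τ ∫ W ln(p_θ) p_{θ_k} dm`
with `τ ∈ (0,1]`, then
`KL(π, p_{θ_{k+1}}) + ((1-τ)/(τZ)) KL(p_{θ_k}, p_{θ_{k+1}}) ≤ KL(π, p_{θ_k})`. -/
theorem igo_ml_KL_decrease
    {X : Type*} [MeasurableSpace X] {Θ : Type*} (m : Measure X) [SigmaFinite m]
    (p : Θ → X → ℝ)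
    (hp_meas : ∀ θ, Measurable (p θ))
    (hp_pos : ∀ θ x, 0 < p θ x)
    (hp_int : ∀ θ, Integrable (p θ) m)
    (hp_one : ∀ θ, ∫ x, p θ x ∂m = 1)
    (θk : Θ)
    (W : X → ℝ) (hW_meas : Measurable W) (hW_nonneg : ∀ x, 0 ≤ W x)
    (Z : ℝ) (hZ : Z = ∫ x, W x * p θk x ∂m) (hZ_pos : 0 < Z)
    (hZ_int : Integrable (fun x => W x * p θk x) m)
    (π : X → ℝ) (hπ : ∀ x, π x = W x * p θk x / Z)
    (τ : ℝ) (hτ : τ ∈ Ioc (0:ℝ) 1)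
    (hint_log : ∀ θ, Integrable (fun x => Real.log (p θ x) * p θk x) m)
    (hint_Wlog : ∀ θ, Integrable (fun x => W x * Real.log (p θ x) * p θk x) m)
    (hint_KLπ : ∀ θ, Integrable (fun x => π x * Real.log (π x / p θ x)) m)
    (hint_KLk : ∀ θ, Integrable (fun x => p θk x * Real.log (p θk x / p θ x)) m)
    (θk1 : Θ)
    (hmax : ∀ θ : Θ,
      (1 - τ) * ∫ x, Real.log (p θ x) * p θk x ∂m
          + τ * ∫ x, W x * Real.log (p θ x) * p θk x ∂m
        ≤ (1 - τ) * ∫ x, Real.log (p θk1 x) * p θk x ∂m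
          + τ * ∫ x, W x * Real.log (p θk1 x) * p θk x ∂m) :
    (∫ x, π x * Real.log (π x / p θk1 x) ∂m)
        + ((1 - τ) / (τ * Z)) * ∫ x, p θk x * Real.log (p θk x / p θk1 x) ∂m
      ≤ ∫ x, π x * Real.log (π x / p θk x) ∂m := by
  obtain ⟨hτ0, hτ1⟩ := hτ
  have h1 : ∫ x, p θk x * Real.log (p θk x / p θk1 x) ∂m
      = (∫ x, Real.log (p θk x) * p θk x ∂m) - ∫ x, Real.log (p θk1 x) * p θk x ∂m := by
    rw [← integral_sub (hint_log θk) (hint_log θk1)]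
    refine integral_congr_ae (Filter.Eventually.of_forall fun x => ?_)
    simp only
    rw [Real.log_div (hp_pos _ _).ne' (hp_pos _ _).ne']
    ring
  have h2 : (∫ x, π x * Real.log (π x / p θk1 x) ∂m) - ∫ x, π x * Real.log (π x / p θk x) ∂m
      = Z⁻¹ * ((∫ x, W x * Real.log (p θk x) * p θk x ∂m)
        - ∫ x, W x * Real.log (p θk1 x) * p θk x ∂m) := by
    rw [← integral_sub (hint_KLπ θk1) (hint_KLπ θk),
      ← integral_sub (hint_Wlog θk) (hint_Wlog θk1), ← integral_const_mul]
    refine integral_congr_ae (Filter.Eventually.of_forall fun x => ?_)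
    simp only
    by_cases hx : π x = 0
    · have hW : W x = 0 := by
        have h := hπ x
        rw [hx, eq_comm, div_eq_zero_iff, mul_eq_zero] at h
        rcases h with (h | h) | h
        · exact h
        · exact absurd h (hp_pos _ _).ne'
        · exact absurd h hZ_pos.ne'
      simp [hx, hW]
    · rw [Real.log_div hx (hp_pos _ _).ne', Real.log_div hx (hp_pos _ _).ne', hπ x]
      ring
  have h3 := hmax θk
  rw [h1]
  generalize (∫ x, Real.log (p θk x) * p θk x ∂m) = A at *
  generalize (∫ x, Real.log (p θk1 x) * p θk x ∂m) = A1 at *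
  generalize (∫ x, W x * Real.log (p θk x) * p θk x ∂m) = B at *
  generalize (∫ x, W x * Real.log (p θk1 x) * p θk x ∂m) = B1 at *
  have h4 : Z⁻¹ * (B - B1) + (1 - τ) / (τ * Z) * (A - A1)
      = ((1 - τ) * A + τ * B - ((1 - τ) * A1 + τ * B1)) / (τ * Z) := by
    field_simp
    ring
  have h5 : ((1 - τ) * A + τ * B - ((1 - τ) * A1 + τ * B1)) / (τ * Z) ≤ 0 :=
    div_nonpos_of_nonpos_of_nonneg (by linarith) (by positivity)
  linarith
end
end

section
/- Let d ≥ 1, ν > 0, μ_k ∈ ℝ^d, and let Σ_k be a d×d positive definite matrix; let p_k = T(·; μ_k, Σ_k, ν) be the corresponding Student density on ℝ^d. Let π be a probability density on ℝ^d with respect to the Lebesgue measure with KL(π, p_k) < ∞ and finite second moments. Define γ(x) = (ν + d)/(ν + (x−μ_k)ᵀ Σ_k⁻¹ (x−μ_k)), and the heavy-tail ML update μ_{k+1} = E_{X∼π}[γ(X) X] / E_{X∼π}[γ(X)] and Σ_{k+1} = E_{X∼π}[γ(X) X Xᵀ] / E_{X∼π}[γ(X)] − μ_{k+1} μ_{k+1}ᵀ,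 assuming Σ_{k+1} is positive definite. Then KL(π, T(·; μ_{k+1}, Σ_{k+1}, ν)) ≤ KL(π, T(·; μ_k, Σ_k, ν)). -/
open MeasureTheory Matrix Set

noncomputable section

/-- The multivariate Student density `T(x; μ, Σ, ν)` on `ℝ^d`. -/
def studentT {d : ℕ} (μ : Fin d → ℝ) (S : Matrix (Fin d) (Fin d) ℝ) (ν : ℝ)
    (x : Fin d → ℝ) : ℝ :=
  (Real.Gamma ((ν + d) / 2) /
      (Real.Gamma (ν / 2) * (ν * Real.pi) ^ ((d : ℝ) / 2) * Real.sqrt S.det)) *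
    (1 + ((x - μ) ⬝ᵥ (S⁻¹ *ᵥ (x - μ))) / ν) ^ (-((ν + d) / 2))

lemma logdet_aux {d : ℕ} {M : Matrix (Fin d) (Fin d) ℝ} (hM : M.PosDef) :
    Real.log M.det ≤ M.trace - d := by
  have h1 := hM.isHermitian.det_eq_prod_eigenvalues
  have h2 := hM.isHermitian.trace_eq_sum_eigenvalues
  simp only [RCLike.ofReal_real_eq_id, id] at h1 h2
  rw [h1, h2, Real.log_prod (fun i _ => (hM.eigenvalues_pos i).ne')]
  have : ∑ i, Real.log (hM.isHermitian.eigenvalues i)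
      ≤ ∑ i, (hM.isHermitian.eigenvalues i - 1) :=
    Finset.sum_le_sum fun i _ => Real.log_le_sub_one_of_pos (hM.eigenvalues_pos i)
  simpa using this

open scoped MatrixOrder in
lemma logdet_aux2 {d : ℕ} {A B : Matrix (Fin d) (Fin d) ℝ} (hA : A.PosDef) (hB : B.PosDef)
    {c : ℝ} (hc : 0 < c) :
    Real.log B.det - Real.log A.det + d * Real.log c ≤ c * (A⁻¹ * B).trace - d := by
  have hAi := hA.inv
  obtain ⟨C, hC⟩ := CStarAlgebra.nonneg_iff_eq_star_mul_self.mp hAi.posSemidef.nonneg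
  rw [star_eq_conjTranspose] at hC
  have hdet : (C * B * Cᴴ).det = A.det⁻¹ * B.det := by
    have : A⁻¹.det = A.det⁻¹ := by simp
    rw [← this, hC]
    simp only [det_mul]; ring
  have hpsd : (C * B * Cᴴ).PosDef := by
    have h0 := hB.posSemidef.mul_mul_conjTranspose_same C
    rw [h0.posDef_iff_det_ne_zero, hdet]
    exact mul_ne_zero (inv_ne_zero hA.det_pos.ne') hB.det_pos.ne'
  have htr : (C * B * Cᴴ).trace = (A⁻¹ * B).trace := by
    rw [hC, trace_mul_comm, ← mul_assoc]
  have := logdet_aux (hpsd.smul hc)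
  rw [det_smul, trace_smul, htr, hdet, Fintype.card_fin, smul_eq_mul,
    Real.log_mul (by positivity) (mul_ne_zero (inv_ne_zero hA.det_pos.ne') hB.det_pos.ne'),
    Real.log_mul (inv_ne_zero hA.det_pos.ne') hB.det_pos.ne', Real.log_pow, Real.log_inv] at this
  linarith

lemma quad_expand {d : ℕ} (P : Matrix (Fin d) (Fin d) ℝ) (μ x : Fin d → ℝ) :
    (x - μ) ⬝ᵥ (P *ᵥ (x - μ)) = ∑ i, ∑ j, P i j * ((x i - μ i) * (x j - μ j)) := by
  simp only [dotProduct, mulVec, Finset.mul_sum, Pi.sub_apply]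
  refine Finset.sum_congr rfl fun i _ => Finset.sum_congr rfl fun j _ => by ring

lemma quad_nonneg {d : ℕ} {S : Matrix (Fin d) (Fin d) ℝ} (hS : S.PosDef) (μ x : Fin d → ℝ) :
    0 ≤ (x - μ) ⬝ᵥ (S⁻¹ *ᵥ (x - μ)) := by
  simpa using hS.inv.posSemidef.dotProduct_mulVec_nonneg (x - μ)

lemma quad_cont {d : ℕ} (P : Matrix (Fin d) (Fin d) ℝ) (μ : Fin d → ℝ) :
    Continuous fun x : Fin d → ℝ => (x - μ) ⬝ᵥ (P *ᵥ (x - μ)) := by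
  simp only [quad_expand]
  fun_prop

lemma quad_integrable {d : ℕ} (P : Matrix (Fin d) (Fin d) ℝ) (μ : Fin d → ℝ)
    {w : (Fin d → ℝ) → ℝ} (h0 : Integrable w) (h1 : ∀ i, Integrable (fun x => w x * x i))
    (h2 : ∀ i j, Integrable (fun x => w x * (x i * x j))) :
    Integrable (fun x => w x * ((x - μ) ⬝ᵥ (P *ᵥ (x - μ)))) ∧
    ∫ x, w x * ((x - μ) ⬝ᵥ (P *ᵥ (x - μ))) = ∑ i, ∑ j, P i j *
      ((∫ x, w x * (x i * x j)) - μ j * (∫ x, w x * x i) - μ i * (∫ x, w x * x j)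
        + μ i * μ j * ∫ x, w x) := by
  have e : (fun x => w x * ((x - μ) ⬝ᵥ (P *ᵥ (x - μ)))) = fun x => ∑ i, ∑ j, P i j *
      (w x * (x i * x j) - μ j * (w x * x i) - μ i * (w x * x j) + μ i * μ j * w x) := by
    funext x
    simp only [quad_expand, Finset.mul_sum]
    refine Finset.sum_congr rfl fun i _ => Finset.sum_congr rfl fun j _ => by ring
  have a1 : ∀ i j, Integrable (fun x => w x * (x i * x j) - μ j * (w x * x i)) := fun i j =>
    (h2 i j).sub ((h1 i).const_mul _)
  have a2 : ∀ i j, Integrable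
      (fun x => w x * (x i * x j) - μ j * (w x * x i) - μ i * (w x * x j)) := fun i j =>
    (a1 i j).sub ((h1 j).const_mul _)
  have a3 : ∀ i j, Integrable (fun x => w x * (x i * x j) - μ j * (w x * x i)
      - μ i * (w x * x j) + μ i * μ j * w x) := fun i j =>
    (a2 i j).add (h0.const_mul _)
  rw [e]
  have a4 : ∀ i j, Integrable (fun x => P i j * (w x * (x i * x j) - μ j * (w x * x i)
      - μ i * (w x * x j) + μ i * μ j * w x)) := fun i j => (a3 i j).const_mul _
  constructor
  · exact integrable_finsetSum _ fun i _ => integrable_finsetSum _ fun j _ =>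
      (a3 i j).const_mul _
  · rw [integral_finsetSum _ fun i _ => integrable_finsetSum _ fun j _ => a4 i j]
    refine Finset.sum_congr rfl fun i _ => ?_
    rw [integral_finsetSum _ fun j _ => a4 i j]
    refine Finset.sum_congr rfl fun j _ => ?_
    rw [integral_const_mul, integral_add (a2 i j) (h0.const_mul _),
      integral_sub (a1 i j) ((h1 j).const_mul _), integral_sub (h2 i j) ((h1 i).const_mul _),
      integral_const_mul, integral_const_mul, integral_const_mul]

lemma quad_integral {d : ℕ} (P : Matrix (Fin d) (Fin d) ℝ) (μ m : Fin d → ℝ)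
    (S : Matrix (Fin d) (Fin d) ℝ) (hS : S.IsSymm) (c : ℝ)
    {w : (Fin d → ℝ) → ℝ} (h0 : Integrable w) (h1 : ∀ i, Integrable (fun x => w x * x i))
    (h2 : ∀ i j, Integrable (fun x => w x * (x i * x j)))
    (e0 : ∫ x, w x = c) (e1 : ∀ i, ∫ x, w x * x i = c * m i)
    (e2 : ∀ i j, ∫ x, w x * (x i * x j) = c * (S i j + m i * m j)) :
    ∫ x, w x * ((x - μ) ⬝ᵥ (P *ᵥ (x - μ))) =
      c * ((P * S).trace + (m - μ) ⬝ᵥ (P *ᵥ (m - μ))) := by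
  rw [(quad_integrable P μ h0 h1 h2).2, quad_expand]
  simp only [e0, e1, e2, trace, diag, mul_apply, ← Finset.sum_add_distrib, Finset.mul_sum]
  refine Finset.sum_congr rfl fun i _ => Finset.sum_congr rfl fun j _ => ?_
  rw [hS.apply i j]; ring

lemma log_studentT {d : ℕ} {μ : Fin d → ℝ} {S : Matrix (Fin d) (Fin d) ℝ} {ν : ℝ} (hν : 0 < ν)
    (hS : S.PosDef) (x : Fin d → ℝ) :
    0 < studentT μ S ν x ∧ Real.log (studentT μ S ν x) =
      Real.log (Real.Gamma ((ν + d) / 2) / (Real.Gamma (ν / 2) * (ν * Real.pi) ^ ((d : ℝ) / 2)))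
       + (ν + d) / 2 * Real.log ν - 1 / 2 * Real.log S.det
       - (ν + d) / 2 * Real.log (ν + (x - μ) ⬝ᵥ (S⁻¹ *ᵥ (x - μ))) := by
  have hq := quad_nonneg hS μ x
  have hdet := hS.det_pos
  have g1 : 0 < Real.Gamma ((ν + d) / 2) := Real.Gamma_pos_of_pos (by positivity)
  have g2 : 0 < Real.Gamma (ν / 2) := Real.Gamma_pos_of_pos (by positivity)
  have g3 : 0 < (ν * Real.pi) ^ ((d : ℝ) / 2) := by positivity
  have e : 1 + ((x - μ) ⬝ᵥ (S⁻¹ *ᵥ (x - μ))) / ν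
      = (ν + (x - μ) ⬝ᵥ (S⁻¹ *ᵥ (x - μ))) / ν := by field_simp
  unfold studentT
  rw [e]
  generalize (x - μ) ⬝ᵥ (S⁻¹ *ᵥ (x - μ)) = q at *
  constructor
  · positivity
  · rw [← div_div, Real.log_mul (by positivity) (by positivity),
      Real.log_div (by positivity) (by positivity), Real.log_rpow (by positivity),
      Real.log_div (x := ν + q) (by positivity) hν.ne', Real.log_sqrt hdet.le]
    ring

lemma integrable_log_quad {d : ℕ} {μ : Fin d → ℝ} {S : Matrix (Fin d) (Fin d) ℝ} {ν : ℝ}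
    (hν : 0 < ν) (hS : S.PosDef) {w : (Fin d → ℝ) → ℝ}
    (h0 : Integrable w) (h1 : ∀ i, Integrable (fun x => w x * x i))
    (h2 : ∀ i j, Integrable (fun x => w x * (x i * x j))) :
    Integrable (fun x => w x * Real.log (ν + (x - μ) ⬝ᵥ (S⁻¹ *ᵥ (x - μ)))) := by
  have hi := (h0.const_mul (|Real.log ν| + ν)).add (quad_integrable S⁻¹ μ h0 h1 h2).1
  refine hi.mono ?_ (Filter.Eventually.of_forall fun x => ?_)
  · refine h0.aestronglyMeasurable.mul ?_
    exact (Real.measurable_log.comp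
      ((quad_cont S⁻¹ μ).measurable.const_add ν)).aestronglyMeasurable
  · have hq := quad_nonneg hS μ x
    simp only [Pi.add_apply]
    generalize (x - μ) ⬝ᵥ (S⁻¹ *ᵥ (x - μ)) = q at *
    rw [show (|Real.log ν| + ν) * w x + w x * q = w x * (|Real.log ν| + ν + q) by ring,
      norm_mul, norm_mul]
    refine mul_le_mul_of_nonneg_left ?_ (norm_nonneg _)
    have p : 0 < ν + q := by positivity
    have l1 := Real.log_le_sub_one_of_pos p
    have l2 := Real.log_le_log hν (by linarith : ν ≤ ν + q)
    have l3 := neg_abs_le (Real.log ν)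
    have l4 := abs_nonneg (Real.log ν)
    rw [Real.norm_eq_abs, Real.norm_eq_abs, abs_of_nonneg (by positivity : 0 ≤ |Real.log ν| + ν + q)]
    exact abs_le.2 ⟨by linarith, by linarith⟩

/-- **Proposition 7: the heavy-tail ML update does not increase the KL divergence
to the target.** With `γ(x) = (ν+d)/(ν + (x-μ_k)ᵀΣ_k⁻¹(x-μ_k))`,
`μ_{k+1} = E_π[γX]/E_π[γ]` and `Σ_{k+1} = E_π[γXXᵀ]/E_π[γ] - μ_{k+1}μ_{k+1}ᵀ`,
one has `KL(π, T(·;μ_{k+1},Σ_{k+1},ν)) ≤ KL(π, T(·;μ_k,Σ_k,ν))`. -/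
theorem heavy_tail_ML_KL_decrease
    {d : ℕ} (hd : 1 ≤ d) (ν : ℝ) (hν : 0 < ν)
    (μk : Fin d → ℝ) (Sk : Matrix (Fin d) (Fin d) ℝ) (hSk : Sk.PosDef)
    (π : (Fin d → ℝ) → ℝ)
    (hπ_meas : Measurable π) (hπ_nonneg : ∀ x, 0 ≤ π x)
    (hπ_int : Integrable π) (hπ_one : ∫ x, π x = 1)
    (hmom1 : ∀ i, Integrable (fun x => π x * x i))
    (hmom2 : ∀ i j, Integrable (fun x => π x * (x i * x j)))
    (γ : (Fin d → ℝ) → ℝ)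
    (hγ : ∀ x, γ x = (ν + d) / (ν + (x - μk) ⬝ᵥ (Sk⁻¹ *ᵥ (x - μk))))
    (c : ℝ) (hc : c = ∫ x, γ x * π x) (hc_pos : 0 < c)
    (μk1 : Fin d → ℝ) (hμk1 : μk1 = c⁻¹ • ∫ x, (γ x * π x) • x)
    (Sk1 : Matrix (Fin d) (Fin d) ℝ)
    (hSk1 : ∀ i j, Sk1 i j = c⁻¹ * (∫ x, γ x * π x * (x i * x j)) - μk1 i * μk1 j)
    (hSk1_pd : Sk1.PosDef)
    (hKL_fin : Integrable (fun x => π x * Real.log (π x / studentT μk Sk ν x))) :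
    (∫ x, π x * Real.log (π x / studentT μk1 Sk1 ν x))
      ≤ ∫ x, π x * Real.log (π x / studentT μk Sk ν x) := by
  have hγ_meas : Measurable γ := by
    have : γ = fun x => (ν + d) / (ν + (x - μk) ⬝ᵥ (Sk⁻¹ *ᵥ (x - μk))) := funext hγ
    rw [this]
    exact ((quad_cont Sk⁻¹ μk).measurable.const_add ν).const_div _
  have hq := fun x => quad_nonneg hSk μk x
  have hq1 := fun x => quad_nonneg hSk1_pd μk1 x
  have hγ_pos : ∀ x, 0 < γ x := fun x => by
    have := hq x
    rw [hγ]; positivity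
  have hγ_bd : ∀ᵐ x : Fin d → ℝ, ‖γ x‖ ≤ (ν + d) / ν := Filter.Eventually.of_forall fun x => by
    rw [Real.norm_eq_abs, abs_of_pos (hγ_pos x), hγ]
    have := hq x
    gcongr
    linarith
  have w0 : Integrable (fun x => γ x * π x) := hπ_int.bdd_mul hγ_meas.aestronglyMeasurable hγ_bd
  have w1 : ∀ i, Integrable (fun x => γ x * π x * x i) := fun i => by
    simpa only [mul_assoc] using (hmom1 i).bdd_mul hγ_meas.aestronglyMeasurable hγ_bd
  have w2 : ∀ i j, Integrable (fun x => γ x * π x * (x i * x j)) := fun i j => by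
    simpa only [mul_assoc] using (hmom2 i j).bdd_mul hγ_meas.aestronglyMeasurable hγ_bd
  have e1 : ∀ i, ∫ x, γ x * π x * x i = c * μk1 i := fun i => by
    rw [hμk1, Pi.smul_apply, eval_integral (fun i => by simpa using w1 i)]
    simp only [Pi.smul_apply, smul_eq_mul]
    field_simp
  have e2 : ∀ i j, ∫ x, γ x * π x * (x i * x j) = c * (Sk1 i j + μk1 i * μk1 j) := fun i j => by
    rw [hSk1]
    field_simp
    ring
  have hsymm : Sk1.IsSymm := by simpa using hSk1_pd.isHermitian
  have I1 := quad_integral Sk1⁻¹ μk1 μk1 Sk1 hsymm c w0 w1 w2 hc.symm e1 e2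
  have Ik := quad_integral Sk⁻¹ μk μk1 Sk1 hsymm c w0 w1 w2 hc.symm e1 e2
  have i1 := (quad_integrable Sk1⁻¹ μk1 w0 w1 w2).1
  have ik := (quad_integrable Sk⁻¹ μk w0 w1 w2).1
  rw [nonsing_inv_mul _ (isUnit_iff_ne_zero.2 hSk1_pd.det_pos.ne'), trace_one, sub_self,
    zero_dotProduct, add_zero, Fintype.card_fin] at I1
  -- total mass identity
  have Ik' : ν * c + ∫ x, γ x * π x * ((x - μk) ⬝ᵥ (Sk⁻¹ *ᵥ (x - μk))) = ν + d := by
    have h : ∫ x, (ν * (γ x * π x) + γ x * π x * ((x - μk) ⬝ᵥ (Sk⁻¹ *ᵥ (x - μk))))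
        = ∫ x, (ν + d) * π x := by
      congr 1
      funext x
      have := hq x
      rw [hγ]
      have : ν + (x - μk) ⬝ᵥ (Sk⁻¹ *ᵥ (x - μk)) ≠ 0 := by positivity
      field_simp
    rw [integral_add (w0.const_mul _) ik, integral_const_mul, integral_const_mul, hπ_one,
      ← hc] at h
    linarith
  have hld := logdet_aux2 hSk hSk1_pd hc_pos
  have hlc := Real.log_le_sub_one_of_pos hc_pos
  have hqm := mul_nonneg hc_pos.le (hq μk1)
  set D := Real.log Sk1.det - Real.log Sk.det with hD
  have hmain : D + (ν + d) * Real.log c ≤ 0 := by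
    have := mul_le_mul_of_nonneg_left hlc hν.le
    rw [Ik] at Ik'
    nlinarith
  -- pointwise
  have L1 := integrable_log_quad (μ := μk1) hν hSk1_pd hπ_int hmom1 hmom2
  have Lk := integrable_log_quad (μ := μk) hν hSk hπ_int hmom1 hmom2
  have key : ∀ x, π x * Real.log (π x / studentT μk1 Sk1 ν x)
      = π x * Real.log (π x / studentT μk Sk ν x) + (D / 2 * π x
        + (ν + d) / 2 * (π x * Real.log (ν + (x - μk1) ⬝ᵥ (Sk1⁻¹ *ᵥ (x - μk1)))
          - π x * Real.log (ν + (x - μk) ⬝ᵥ (Sk⁻¹ *ᵥ (x - μk))))) := fun x => by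
    rcases eq_or_ne (π x) 0 with h | h
    · simp [h]
    · obtain ⟨p1, q1⟩ := log_studentT (μ := μk1) hν hSk1_pd x
      obtain ⟨pk, qk⟩ := log_studentT (μ := μk) hν hSk x
      rw [Real.log_div h p1.ne', Real.log_div h pk.ne', q1, qk, hD]
      ring
  have hub : ∀ x, D / 2 * π x
        + (ν + d) / 2 * (π x * Real.log (ν + (x - μk1) ⬝ᵥ (Sk1⁻¹ *ᵥ (x - μk1)))
          - π x * Real.log (ν + (x - μk) ⬝ᵥ (Sk⁻¹ *ᵥ (x - μk)))) ≤
      (D / 2 + (ν + d) / 2 * (Real.log c - 1)) * π x + ((2 * c)⁻¹ * ν * (γ x * π x)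
        + (2 * c)⁻¹ * (γ x * π x * ((x - μk1) ⬝ᵥ (Sk1⁻¹ *ᵥ (x - μk1))))) := fun x => by
    have a := hq x
    have b := hq1 x
    have g := hγ x
    have hp := hπ_nonneg x
    generalize (x - μk) ⬝ᵥ (Sk⁻¹ *ᵥ (x - μk)) = s at *
    generalize (x - μk1) ⬝ᵥ (Sk1⁻¹ *ᵥ (x - μk1)) = t at *
    have p1 : 0 < ν + s := by positivity
    have p2 : 0 < ν + t := by positivity
    have l := Real.log_le_sub_one_of_pos (show 0 < (ν + t) / (c * (ν + s)) by positivity)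
    rw [Real.log_div p2.ne' (by positivity), Real.log_mul hc_pos.ne' p1.ne'] at l
    have l2 := mul_le_mul_of_nonneg_left l (show 0 ≤ (ν + d) / 2 * π x by positivity)
    have e : (ν + d) / 2 * π x * ((ν + t) / (c * (ν + s)) - 1)
        = (2 * c)⁻¹ * ν * (γ x * π x) + (2 * c)⁻¹ * (γ x * π x * t) - (ν + d) / 2 * π x := by
      rw [g]; field_simp
    rw [e] at l2
    linarith
  have G : Integrable (fun x => D / 2 * π x
        + (ν + d) / 2 * (π x * Real.log (ν + (x - μk1) ⬝ᵥ (Sk1⁻¹ *ᵥ (x - μk1)))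
          - π x * Real.log (ν + (x - μk) ⬝ᵥ (Sk⁻¹ *ᵥ (x - μk))))) :=
    (hπ_int.const_mul _).add ((L1.sub Lk).const_mul _)
  have U0 : Integrable (fun x => (2 * c)⁻¹ * ν * (γ x * π x)
        + (2 * c)⁻¹ * (γ x * π x * ((x - μk1) ⬝ᵥ (Sk1⁻¹ *ᵥ (x - μk1))))) := (w0.const_mul ((2 * c)⁻¹ * ν)).add (i1.const_mul (2 * c)⁻¹)
  have hle := integral_mono G ((hπ_int.const_mul
    (D / 2 + (ν + d) / 2 * (Real.log c - 1))).add U0) hub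
  simp only [Pi.add_apply] at hle
  rw [integral_add (hπ_int.const_mul _) U0,
    integral_add (w0.const_mul _) (i1.const_mul _), integral_const_mul, integral_const_mul,
    integral_const_mul, hπ_one, ← hc, I1] at hle
  have ec : (2 * c)⁻¹ * ν * c + (2 * c)⁻¹ * (c * d) = (ν + d) / 2 := by field_simp
  simp only [key]
  rw [integral_add hKL_fin G]
  linarith
end
end

section
/- Let m be a σ-finite measure on a measurable space X, f : X → ℝ measurable, q ∈ (0,1), and let p_k and p_{k+1} be probability densities with respect to m such that P_{X∼p}[f(X) = u] = 0 for every u ∈ ℝ and p ∈ {p_k, p_{k+1}}. Let W_{p_k}^f be the preference function associated with p_k and the indicator weighting w(u) = 1_{u ≤ q}, set Z := ∫ W_{p_k}^f(x) p_k(x) m(dx), assume Z = q, and let π = W_{p_k}^f p_k / Z be the target density. Assume that for m-a.e. x with π(x) > 0 one has p_k(x) > 0 and p_{k+1}(x) > 0. If, for some Δ > 0 and some α ∈ (0,1], the divergence decrease D_α(π, p_{k+1}) + Δ ≤ D_α(π, p_k) holds (with α = 1 understood as KL(π, p_{k+1}) + Δ ≤ KL(π, p_k)), and the divergences involved are finite,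 then Q_{p_{k+1}}^q(f) < Q_{p_k}^q(f). -/
open MeasureTheory Set

noncomputable section

variable {X : Type*} [MeasurableSpace X]

theorem aux_cdf (m : Measure X) (f : X → ℝ) (hf : Measurable f)
    (p : X → ℝ) (hnn : ∀ x, 0 ≤ p x)
    (hint : Integrable p m) (hone : ∫ x, p x ∂m = 1)
    (hatom : ∀ u : ℝ, ∫ x in {y | f y = u}, p x ∂m = 0) :
    Continuous (probLe m p f) ∧ Monotone (probLe m p f) ∧
    Filter.Tendsto (probLe m p f) Filter.atBot (nhds 0) ∧
    Filter.Tendsto (probLe m p f) Filter.atTop (nhds 1) ∧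
    (∀ u, probGe m p f u = 1 - probLe m p f u) ∧
    (∀ x, qlt m p f x = probLe m p f (f x)) := by
  set ν : Measure X := m.withDensity (fun x => ENNReal.ofReal (p x)) with hν
  set μ : Measure ℝ := ν.map f with hμ
  have hS : ∀ S : Set ℝ, MeasurableSet S → ∫ x in f ⁻¹' S, p x ∂m = μ.real S := by
    intro S hSm
    rw [measureReal_def, hμ, Measure.map_apply hf hSm, hν, withDensity_apply _ (hf hSm),
      integral_eq_lintegral_of_nonneg_ae (Filter.Eventually.of_forall hnn)
        hint.aestronglyMeasurable.restrict]
  have hprobν : IsProbabilityMeasure ν := by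
    constructor
    rw [hν, withDensity_apply _ MeasurableSet.univ, Measure.restrict_univ,
      ← ofReal_integral_eq_lintegral_ofReal hint (Filter.Eventually.of_forall hnn), hone]
    simp
  have hprob : IsProbabilityMeasure μ := Measure.isProbabilityMeasure_map hf.aemeasurable
  have hF : probLe m p f = fun u => ProbabilityTheory.cdf μ u := by
    funext u
    rw [ProbabilityTheory.cdf_eq_real]
    exact hS (Iic u) measurableSet_Iic
  have hna : ∀ u, μ.real {u} = 0 := by
    intro u
    rw [← hS {u} (measurableSet_singleton u)]
    exact hatom u
  have hna' : ∀ u, μ {u} = 0 := fun u => (measureReal_eq_zero_iff).1 (hna u)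
  have : NullSingletonClass μ := ⟨hna'⟩
  refine ⟨?_, ?_, ?_, ?_, ?_, ?_⟩
  · rw [hF, continuous_iff_continuousAt]
    intro u
    rw [(ProbabilityTheory.cdf μ).mono.continuousAt_iff_leftLim_eq_rightLim,
      StieltjesFunction.rightLim_eq]
    have h := (ProbabilityTheory.cdf μ).measure_singleton u
    rw [ProbabilityTheory.measure_cdf, hna' u] at h
    have h2 := ENNReal.ofReal_eq_zero.1 h.symm
    have h3 := (ProbabilityTheory.cdf μ).mono.leftLim_le (le_refl u)
    linarith
  · rw [hF]; exact (ProbabilityTheory.cdf μ).mono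
  · rw [hF]; exact ProbabilityTheory.tendsto_cdf_atBot μ
  · rw [hF]; exact ProbabilityTheory.tendsto_cdf_atTop μ
  · intro u
    have h1 : probGe m p f u = μ.real (Ici u) := hS (Ici u) measurableSet_Ici
    have h2 : probLe m p f u = μ.real (Iic u) := hS (Iic u) measurableSet_Iic
    have h3 : μ.real (Iic u) = μ.real (Iio u) := measureReal_congr Iio_ae_eq_Iic.symm
    rw [h1, h2, h3, ← compl_Iio, probReal_compl_eq_one_sub measurableSet_Iio]
  · intro x
    have h1 : qlt m p f x = μ.real (Iio (f x)) := hS (Iio (f x)) measurableSet_Iio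
    have h2 : probLe m p f (f x) = μ.real (Iic (f x)) := hS (Iic (f x)) measurableSet_Iic
    rw [h1, h2]
    exact measureReal_congr Iio_ae_eq_Iic

theorem aux_quant (m : Measure X) (f : X → ℝ) (hf : Measurable f)
    (p : X → ℝ) (hnn : ∀ x, 0 ≤ p x)
    (hint : Integrable p m) (hone : ∫ x, p x ∂m = 1)
    (hatom : ∀ u : ℝ, ∫ x in {y | f y = u}, p x ∂m = 0)
    (q : ℝ) (hq : q ∈ Ioo (0:ℝ) 1) :
    probLe m p f (quantQ m p f q) = q ∧
    ∀ u, probLe m p f u ≤ q ↔ u ≤ quantQ m p f q := by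
  obtain ⟨hc, hm, h0, h1, hge, -⟩ := aux_cdf m f hf p hnn hint hone hatom
  have hset : {u : ℝ | q ≤ probLe m p f u ∧ 1 - q ≤ probGe m p f u}
      = {u | probLe m p f u = q} := by
    ext u
    simp only [mem_ofPred_eq, hge u]
    constructor
    · rintro ⟨a, b⟩; linarith
    · intro a; constructor <;> linarith
  obtain ⟨a, ha⟩ := (h0.eventually (gt_mem_nhds hq.1)).exists
  obtain ⟨b, hb⟩ := (h1.eventually (lt_mem_nhds hq.2)).exists
  have hbd : ∀ u, probLe m p f u ≤ q → u ≤ b := by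
    intro u hu
    by_contra h
    have := hm (not_le.1 h).le
    linarith
  have hne : {u | probLe m p f u = q}.Nonempty := by
    obtain ⟨u, hu⟩ := mem_range_of_exists_le_of_exists_ge hc ⟨a, ha.le⟩ ⟨b, hb.le⟩
    exact ⟨u, hu⟩
  have hba : BddAbove {u | probLe m p f u = q} := ⟨b, fun u hu => hbd u (le_of_eq hu)⟩
  have hcl : IsClosed {u | probLe m p f u = q} := isClosed_eq hc continuous_const
  have hmem : probLe m p f (quantQ m p f q) = q := by
    have := hcl.csSup_mem hne hba
    unfold quantQ
    rw [hset]
    exact this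
  refine ⟨hmem, fun u => ⟨fun hu => ?_, fun hu => hmem ▸ hm hu⟩⟩
  by_contra h
  have h2 := hm (not_le.1 h).le
  rw [hmem] at h2
  have : u ∈ {u | probLe m p f u = q} := le_antisymm hu h2
  apply h
  unfold quantQ
  rw [hset]
  exact le_csSup hba this

/-- **Corollary 1 (ii).** Under the atomless condition
`P_{X∼p}[f(X) = u] = 0` for all `u` and `p ∈ {p_k, p_{k+1}}`, a strict
divergence decrease `D_α(π, p_{k+1}) + Δ ≤ D_α(π, p_k)` with `Δ > 0` and
`α ∈ (0,1]` (where `α = 1` is the KL case) implies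
`Q_{p_{k+1}}^q(f) < Q_{p_k}^q(f)`. -/
theorem divergence_decrease_implies_strict_quantile_improvement
    (m : Measure X) [SigmaFinite m]
    (f : X → ℝ) (hf : Measurable f) (q : ℝ) (hq : q ∈ Ioo (0:ℝ) 1)
    (pk pk1 : X → ℝ)
    (hpk_meas : Measurable pk) (hpk_nonneg : ∀ x, 0 ≤ pk x)
    (hpk_int : Integrable pk m) (hpk_one : ∫ x, pk x ∂m = 1)
    (hpk1_meas : Measurable pk1) (hpk1_nonneg : ∀ x, 0 ≤ pk1 x)
    (hpk1_int : Integrable pk1 m) (hpk1_one : ∫ x, pk1 x ∂m = 1)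
    (hatom_k : ∀ u : ℝ, ∫ x in {y | f y = u}, pk x ∂m = 0)
    (hatom_k1 : ∀ u : ℝ, ∫ x in {y | f y = u}, pk1 x ∂m = 0)
    (Z : ℝ) (hZ_def : Z = ∫ x, prefW m pk f q x * pk x ∂m) (hZ_eq : Z = q)
    (π : X → ℝ) (hπ : ∀ x, π x = prefW m pk f q x * pk x / Z)
    (hsupp : ∀ᵐ x ∂m, 0 < π x → 0 < pk x ∧ 0 < pk1 x)
    (α : ℝ) (hα : α ∈ Ioc (0:ℝ) 1)
    (Δ : ℝ) (hΔ : 0 < Δ)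
    (hdec :
      (α = 1 ∧
        Integrable (fun x => π x * Real.log (π x / pk x)) m ∧
        Integrable (fun x => π x * Real.log (π x / pk1 x)) m ∧
        (∫ x, π x * Real.log (π x / pk1 x) ∂m) + Δ
          ≤ ∫ x, π x * Real.log (π x / pk x) ∂m) ∨
      (α ∈ Ioo (0:ℝ) 1 ∧
        Integrable (fun x => π x ^ α * pk x ^ (1 - α)) m ∧
        (0 < ∫ x, π x ^ α * pk x ^ (1 - α) ∂m) ∧
        Integrable (fun x => π x ^ α * pk1 x ^ (1 - α)) m ∧
        (0 < ∫ x, π x ^ α * pk1 x ^ (1 - α) ∂m) ∧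
        (α - 1)⁻¹ * Real.log (∫ x, π x ^ α * pk1 x ^ (1 - α) ∂m) + Δ
          ≤ (α - 1)⁻¹ * Real.log (∫ x, π x ^ α * pk x ^ (1 - α) ∂m))) :
    quantQ m pk1 f q < quantQ m pk f q := by
  classical
  obtain ⟨hk1, hk2⟩ := aux_quant m f hf pk hpk_nonneg hpk_int hpk_one hatom_k q hq
  obtain ⟨hl1, hl2⟩ := aux_quant m f hf pk1 hpk1_nonneg hpk1_int hpk1_one hatom_k1 q hq
  obtain ⟨-, -, -, -, -, hqlt⟩ := aux_cdf m f hf pk hpk_nonneg hpk_int hpk_one hatom_k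
  have hq0 := hq.1
  by_contra hcon
  rw [not_lt, ← hl2] at hcon
  set A : Set X := {y | f y ≤ quantQ m pk f q} with hA
  have hAm : MeasurableSet A := hf measurableSet_Iic
  have hW : ∀ x, prefW m pk f q x = if x ∈ A then 1 else 0 := by
    intro x
    have h1 : qle m pk f x = probLe m pk f (f x) := rfl
    unfold prefW
    rw [hqlt, h1, if_pos rfl]
    have := hk2 (f x)
    simp only [this, hA, mem_ofPred_eq]
  have hπ' : ∀ x, π x = A.indicator (fun x => pk x / q) x := by
    intro x
    rw [hπ, hW, hZ_eq]
    by_cases hx : x ∈ A <;> simp [hx]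
  have hπnn : ∀ x, 0 ≤ π x := by
    intro x; rw [hπ']
    exact indicator_nonneg (fun x _ => div_nonneg (hpk_nonneg x) hq0.le) x
  have hπint : Integrable π m := by
    rw [funext hπ']
    exact (hpk_int.div_const q).indicator hAm
  have hπone : ∫ x, π x ∂m = 1 := by
    rw [funext hπ, integral_div, ← hZ_def, hZ_eq]
    exact div_self hq0.ne'
  set r : X → ℝ := A.indicator (fun x => pk1 x / q) with hr
  have hrint : Integrable r m := (hpk1_int.div_const q).indicator hAm
  have hr1 : ∫ x, r x ∂m ≤ 1 := by
    rw [hr, integral_indicator hAm, integral_div]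
    exact (div_le_one hq0).2 hcon
  have hr0 : ∀ x, 0 ≤ r x := fun x =>
    indicator_nonneg (fun x _ => div_nonneg (hpk1_nonneg x) hq0.le) x
  rcases hdec with ⟨-, hi1, hi2, hle⟩ | ⟨hα', hi1, hp1, hi2, hp2, hle⟩
  · have e1 : ∫ x, π x * Real.log (π x / pk x) ∂m = -Real.log q := by
      have : ∀ x, π x * Real.log (π x / pk x) = π x * (-Real.log q) := by
        intro x
        rw [hπ']
        by_cases hx : x ∈ A
        · simp only [indicator_of_mem hx]
          by_cases h0 : pk x = 0
          · simp [h0]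
          · rw [← Real.log_inv]
            congr 2
            field_simp
        · simp [indicator_of_notMem hx]
      rw [funext this, integral_mul_const, hπone, one_mul]
    have j1 : Integrable (fun x => π x * (-Real.log q) + π x) m :=
      (hπint.mul_const _).add hπint
    have j2 : Integrable (fun x => π x * (-Real.log q) + π x - r x) m := j1.sub hrint
    have e2 : ∫ x, (π x * (-Real.log q) + π x - r x) ∂m
        ≤ ∫ x, π x * Real.log (π x / pk1 x) ∂m := by
      apply integral_mono_ae j2 hi2
      filter_upwards [hsupp] with x hx
      rcases (hπnn x).eq_or_lt with h | h
      · show π x * (-Real.log q) + π x - r x ≤ π x * Real.log (π x / pk1 x)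
        rw [← h]
        have := hr0 x
        simp only [zero_mul]
        linarith
      · obtain ⟨-, hb⟩ := hx h
        have hxA : x ∈ A := by
          by_contra hxA
          rw [hπ', indicator_of_notMem hxA] at h
          exact lt_irrefl _ h
        have hrx : r x = pk1 x / q := indicator_of_mem hxA _
        have hl := Real.log_le_sub_one_of_pos (x := pk1 x / q / π x) (by positivity)
        rw [Real.log_div (by positivity) (by positivity),
          Real.log_div hb.ne' hq0.ne'] at hl
        show π x * (-Real.log q) + π x - r x ≤ π x * Real.log (π x / pk1 x)
        rw [hrx, Real.log_div h.ne' hb.ne']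
        have h3 := mul_le_mul_of_nonneg_left hl h.le
        have h4 : π x * (pk1 x / q / π x - 1) = pk1 x / q - π x := by
          field_simp
        rw [h4] at h3
        linarith
    rw [integral_sub j1 hrint,
      integral_add (hπint.mul_const _) hπint, integral_mul_const, hπone] at e2
    linarith
  · obtain ⟨ha0, ha1⟩ := hα'
    have hb0 : 0 < 1 - α := by linarith
    have e1 : ∫ x, π x ^ α * pk x ^ (1 - α) ∂m = q ^ (1 - α) := by
      have : ∀ x, π x ^ α * pk x ^ (1 - α) = π x * q ^ (1 - α) := by
        intro x
        rw [hπ']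
        by_cases hx : x ∈ A
        · simp only [indicator_of_mem hx]
          have h : pk x = pk x / q * q := by field_simp
          have hn : 0 ≤ pk x / q := div_nonneg (hpk_nonneg x) hq0.le
          have h5 : pk x ^ (1 - α) = (pk x / q) ^ (1 - α) * q ^ (1 - α) := by
            rw [← Real.mul_rpow hn hq0.le, ← h]
          rw [h5, ← mul_assoc, ← Real.rpow_add_of_nonneg hn ha0.le hb0.le]
          simp
        · simp [indicator_of_notMem hx, Real.zero_rpow ha0.ne']
      rw [funext this, integral_mul_const, hπone, one_mul]
    have e2 : ∫ x, π x ^ α * pk1 x ^ (1 - α) ∂m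
        ≤ ∫ x, q ^ (1 - α) * (α * π x + (1 - α) * r x) ∂m := by
      apply integral_mono hi2
        (((hπint.const_mul _).add (hrint.const_mul _)).const_mul _)
      intro x
      show π x ^ α * pk1 x ^ (1 - α) ≤ q ^ (1 - α) * (α * π x + (1 - α) * r x)
      by_cases hx : x ∈ A
      · have hrx : pk1 x = r x * q := by
          rw [hr, indicator_of_mem hx]; field_simp
        have hy := Real.geom_mean_le_arith_mean2_weighted ha0.le hb0.le (hπnn x) (hr0 x)
          (by ring)
        rw [hrx, Real.mul_rpow (hr0 x) hq0.le]
        have hqp : 0 ≤ q ^ (1 - α) := Real.rpow_nonneg hq0.le _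
        nlinarith [mul_le_mul_of_nonneg_left hy hqp]
      · have h1 : π x = 0 := by rw [hπ', indicator_of_notMem hx]
        have h2 : r x = 0 := indicator_of_notMem hx _
        rw [h1, h2, Real.zero_rpow ha0.ne']
        simp
    rw [integral_const_mul, integral_add (hπint.const_mul _) (hrint.const_mul _),
      integral_const_mul, integral_const_mul, hπone] at e2
    have hqp : 0 < q ^ (1 - α) := Real.rpow_pos_of_pos hq0 _
    have e3 : ∫ x, π x ^ α * pk1 x ^ (1 - α) ∂m ≤ ∫ x, π x ^ α * pk x ^ (1 - α) ∂m := by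
      rw [e1]
      refine e2.trans (mul_le_of_le_one_right hqp.le ?_)
      nlinarith
    have e4 := Real.log_le_log hp2 e3
    have e5 : (α - 1)⁻¹ ≤ 0 := inv_nonpos.2 (by linarith)
    have e6 := mul_le_mul_of_nonpos_left e4 e5
    linarith
end
end
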